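/- arXiv:2502.08433 — 2 statements merged into one kernel-verified Lean document; each statement's English description precedes it below -/
import Mathlib

section
/- Let α ∈ ℂ with 0 < Re α ≤ 1/2, let k satisfy 0 < k < Re α, set λ = sin(πα)/π, and let g ∈ E_k. Then f ∈ E_k satisfies the Stieltjes equation f(x) = g(x) + λ ∫₀^∞ f(y)/(x+y) dy for almost every x > 0 if and only if f(x) = g(x) + λ ∫₀^∞ R₃(x,y;α)·g(y) dy for almost every x > 0, where the latter integral is absolutely convergent. -/
open MeasureTheory Set Asymptotics

noncomputable section

/-- `r₁(x;α)` from Dixon's resolvent kernels. -/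
def r1 (α : ℂ) (x : ℝ) : ℂ :=
  if α = -(1/2 : ℂ) then
    -(2 / (Real.pi : ℂ)) * ((x : ℂ) ^ ((1 : ℂ)/2) * (Real.log x : ℂ)) / (1 - (x : ℂ) ^ 2)
  else
    (1 / Complex.cos ((Real.pi : ℂ) * α)) *
      (((x : ℂ) ^ (-α) - (x : ℂ) ^ (α + 1)) / (1 - (x : ℂ) ^ 2))

def r2 (α : ℂ) (x : ℝ) : ℂ := -(1 / (x : ℂ)) * r1 (-α) x

def r3 (α : ℂ) (x : ℝ) : ℂ := (x : ℂ) ^ 2 * r2 α x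

def R1 (α : ℂ) (x y : ℝ) : ℂ := (1 / (y : ℂ)) * r1 α (x / y)
def R2 (α : ℂ) (x y : ℝ) : ℂ := (1 / (y : ℂ)) * r2 α (x / y)
def R3 (α : ℂ) (x y : ℝ) : ℂ := (1 / (y : ℂ)) * r3 α (x / y)

/-- membership in `E`: integrable on `(0,∞)` with weight `1/(1+x)`. -/
def MemE (f : ℝ → ℂ) : Prop :=
  IntegrableOn (fun x : ℝ => f x / (1 + (x : ℂ))) (Ioi 0)

/-- membership in `E_k`: integrable on `(0,∞)` with weight `x^{k-1}`. -/
def MemEk (k : ℝ) (f : ℝ → ℂ) : Prop :=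
  IntegrableOn (fun x : ℝ => (x ^ (k - 1) : ℝ) • f x) (Ioi 0)

/-- membership in `B_{ε,η}`. -/
def MemB (ε η : ℝ) (f : ℝ → ℂ) : Prop :=
  ContinuousOn f (Ioi 0) ∧
  ∃ M : ℝ, (∀ x : ℝ, 1 < x → x ^ ε * ‖f x‖ ≤ M) ∧ (∀ x : ℝ, 0 < x → x < 1 → x ^ η * ‖f x‖ ≤ M)

/-- the norm of `B_{ε,η}`. -/
def Bnorm (ε η : ℝ) (f : ℝ → ℂ) : ℝ :=
  sSup ((fun x : ℝ => x ^ ε * ‖f x‖) '' Ioi 1) + sSup ((fun x : ℝ => x ^ η * ‖f x‖) '' Ioo 0 1)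

/-- admissible weight pair `(φ₁,φ₂)`. -/
def AdmissiblePair (φ₁ φ₂ : ℝ → ℝ) : Prop :=
  ContinuousOn φ₁ (Ioi 0) ∧ ContinuousOn φ₂ (Ioi 0) ∧
  (∀ y : ℝ, 0 < y → (φ₁ y ∈ Ioo (0:ℝ) 1 ∧ φ₂ y ∈ Ioo (0:ℝ) 1 ∧ φ₁ y + φ₂ y = 1)) ∧
  φ₁ =O[Filter.atTop] (fun y : ℝ => 1 / y) ∧
  (fun y : ℝ => φ₁ y - 1) =O[nhdsWithin 0 (Ioi 0)] (fun y : ℝ => y)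

/-- the combined kernel `R₂₃`. -/
def R23 (φ₁ φ₂ : ℝ → ℝ) (α : ℂ) (x y : ℝ) : ℂ :=
  (φ₁ y : ℂ) * R2 α x y + (φ₂ y : ℂ) * R3 α x y


open scoped FourierTransform ContDiff in
/-- The Fourier transform is injective on `L¹`. -/
theorem ae_eq_zero_of_fourier_eq_zero {h : ℝ → ℂ} (hh : Integrable h)
    (h0 : ∀ w, 𝓕 h w = 0) : ∀ᵐ x, h x = 0 := by
  refine ae_eq_zero_of_integral_contDiff_smul_eq_zero hh.locallyIntegrable fun φ hφ hφc => ?_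
  have hc : HasCompactSupport (Complex.ofRealCLM ∘ φ) := hφc.comp_left rfl
  have hd : ContDiff ℝ ∞ (Complex.ofRealCLM ∘ φ) := by fun_prop
  set ψ : SchwartzMap ℝ ℂ := hc.toSchwartzMap hd
  have hψ : ∀ x, ψ x = φ x := fun x => rfl
  set χ : SchwartzMap ℝ ℂ := 𝓕⁻ ψ
  have hinv : 𝓕 χ = ψ := FourierTransform.fourier_fourierInv_eq ψ
  have key := VectorFourier.integral_fourierIntegral_smul_eq_flip (L := innerₗ ℝ) (μ := volume)
    (ν := volume) Real.continuous_fourierChar continuous_inner χ.integrable hh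
  have e1 : ∀ x, VectorFourier.fourierIntegral Real.fourierChar volume (innerₗ ℝ) χ x
      = φ x := by
    intro x
    rw [← hψ, ← hinv]
    rfl
  have e2 : ∀ x, VectorFourier.fourierIntegral Real.fourierChar volume (innerₗ ℝ).flip h x
      = 0 := by
    intro x
    rw [flip_innerₗ]
    exact h0 x
  simp only [e1, e2, smul_zero, integral_zero] at key
  simpa using key

open scoped FourierTransform in
/-- A function with convergent Mellin integral on a vertical line is determined almost everywhere
by the values of its Mellin transform on that line. -/
theorem ae_eq_zero_of_mellin_eq_zero {f : ℝ → ℂ} {k : ℝ} (hf : MellinConvergent f k)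
    (h0 : ∀ s : ℂ, s.re = k → mellin f s = 0) :
    ∀ᵐ x ∂(volume.restrict (Ioi (0 : ℝ))), f x = 0 := by
  set h : ℝ → ℂ := fun u => Real.exp (-k * u) • f (Real.exp (-u))
  have himg : (fun u : ℝ => Real.exp (-u)) '' univ = Ioi 0 := by
    ext x
    simp only [image_univ, mem_range, mem_Ioi]
    exact ⟨fun ⟨u, hu⟩ => hu ▸ Real.exp_pos _, fun hx => ⟨-Real.log x, by simp [Real.exp_log hx]⟩⟩
  have hder : ∀ x ∈ (univ : Set ℝ), HasDerivWithinAt (fun u : ℝ => Real.exp (-u))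
      (-Real.exp (-x)) univ x := by
    intro x _
    exact (mul_neg_one (Real.exp (-x)) ▸
      ((Real.hasDerivAt_exp (-x)).comp x (hasDerivAt_neg x))).hasDerivWithinAt
  have hinj : InjOn (fun u : ℝ => Real.exp (-u)) univ := fun a _ b _ hab => by simpa using hab
  have hint : Integrable h := by
    rw [MellinConvergent, ← himg, integrableOn_image_iff_integrableOn_abs_deriv_smul
      MeasurableSet.univ hder hinj, integrableOn_univ] at hf
    refine hf.congr (Filter.Eventually.of_forall fun u => ?_)
    simp only [h, abs_neg, Real.abs_exp]
    rw [← Complex.ofReal_one, ← Complex.ofReal_sub, ← Complex.ofReal_cpow (Real.exp_pos _).le,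
      smul_eq_mul, Complex.real_smul, Complex.real_smul, ← mul_assoc, ← Complex.ofReal_mul,
      ← Real.exp_mul, ← Real.exp_add]
    ring_nf
  have hF : ∀ w, 𝓕 h w = 0 := by
    intro w
    have := mellin_eq_fourier f (s := (k : ℂ) + (2 * Real.pi * w : ℝ) * Complex.I)
    rw [h0 _ (by simp)] at this
    rw [this]
    have hpi := Real.pi_ne_zero
    simp only [Complex.add_re, Complex.ofReal_re, Complex.mul_re, Complex.I_re, Complex.I_im,
      Complex.ofReal_im, Complex.add_im, Complex.mul_im, h]
    simp
  have hz := ae_eq_zero_of_fourier_eq_zero hint hF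
  have hnull : volume {u : ℝ | ¬ h u = 0} = 0 := hz
  have himgnull := addHaar_image_eq_zero_of_differentiableOn_of_addHaar_eq_zero volume
    (f := fun u : ℝ => Real.exp (-u)) (fun u _ => by fun_prop) hnull
  rw [ae_restrict_iff' measurableSet_Ioi]
  refine measure_mono_null (fun x hx => ?_) himgnull
  simp only [mem_compl_iff, mem_ofPred_eq, Classical.not_imp] at hx
  refine ⟨-Real.log x, ?_, by simp [Real.exp_log hx.1]⟩
  simp [h, Real.exp_log hx.1, hx.2]

theorem MellinConvergent.aestronglyMeasurable {f : ℝ → ℂ} {s : ℂ} (hf : MellinConvergent f s) :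
    AEStronglyMeasurable f (volume.restrict (Ioi 0)) := by
  have hm : AEStronglyMeasurable (fun t : ℝ => (t : ℂ) ^ (1 - s)) (volume.restrict (Ioi 0)) :=
    Measurable.aestronglyMeasurable (by fun_prop)
  refine (hm.mul hf.1).congr ((ae_restrict_mem measurableSet_Ioi).mono fun t ht => ?_)
  have ht' : (t : ℂ) ≠ 0 := Complex.ofReal_ne_zero.2 (ne_of_gt ht)
  simp only [Pi.mul_apply, smul_eq_mul]
  rw [← mul_assoc, ← Complex.cpow_add _ _ ht']
  simp

theorem MellinConvergent.congr_re {f : ℝ → ℂ} {s s' : ℂ} (hf : MellinConvergent f s)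
    (h : s'.re = s.re) : MellinConvergent f s' := by
  have hm := hf.aestronglyMeasurable
  rw [MellinConvergent, mellin_convergent_iff_norm Subset.rfl measurableSet_Ioi hm] at hf ⊢
  rwa [h]

theorem MellinConvergent.congr_fun {f g : ℝ → ℂ} {s : ℂ} (hf : MellinConvergent f s)
    (h : f =ᵐ[volume.restrict (Ioi 0)] g) : MellinConvergent g s :=
  Integrable.congr hf (h.mono fun t ht => by simp only [ht])

theorem mellin_congr_fun {f g : ℝ → ℂ} (s : ℂ)
    (h : f =ᵐ[volume.restrict (Ioi 0)] g) : mellin f s = mellin g s :=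
  integral_congr_ae (h.mono fun t ht => by simp only [ht])

/-- Multiplicative convolution of two functions on `(0, ∞)`. -/
def mulConv (K g : ℝ → ℂ) (x : ℝ) : ℂ :=
  ∫ y in Ioi (0 : ℝ), (1 / (y : ℂ)) * K (x / y) * g y

theorem integrable_prod_mulConv {Q G : ℝ → ℂ} (hQm : Measurable Q)
    (hQ : IntegrableOn Q (Ioi 0)) (hG : IntegrableOn G (Ioi 0)) :
    Integrable (fun p : ℝ × ℝ => (1 / (p.2 : ℂ)) * Q (p.1 / p.2) * G p.2)
      ((volume.restrict (Ioi 0)).prod (volume.restrict (Ioi 0))) := by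
  have hm : AEStronglyMeasurable (fun p : ℝ × ℝ => (1 / (p.2 : ℂ)) * Q (p.1 / p.2) * G p.2)
      ((volume.restrict (Ioi 0)).prod (volume.restrict (Ioi 0))) := by
    refine AEStronglyMeasurable.mul (Measurable.aestronglyMeasurable ?_) hG.1.comp_snd
    exact (by fun_prop : Measurable fun p : ℝ × ℝ => 1 / (p.2 : ℂ)).mul
      (hQm.comp (by fun_prop))
  rw [integrable_prod_iff' hm]
  constructor
  · refine (ae_restrict_mem measurableSet_Ioi).mono fun y hy => ?_
    have h := (integrableOn_Ioi_comp_mul_right_iff Q 0 (inv_pos.2 (mem_Ioi.1 hy))).2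
      (by simpa using hQ)
    simp only [div_eq_mul_inv]
    exact (h.const_mul _).mul_const _
  · refine (hG.norm.const_mul (∫ x in Ioi (0 : ℝ), ‖Q x‖)).congr
      ((ae_restrict_mem measurableSet_Ioi).mono fun y hy => ?_)
    have hy' : 0 < y := hy
    have h := integral_comp_mul_right_Ioi (fun x => ‖Q x‖) 0 (inv_pos.2 hy')
    simp only [norm_mul, div_eq_mul_inv, integral_mul_const, integral_const_mul, h]
    simp only [zero_mul, inv_inv, smul_eq_mul, one_mul, norm_one, norm_inv, Complex.norm_real,
      Real.norm_eq_abs, abs_of_pos hy']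
    field_simp

/-- The Mellin transform turns multiplicative convolution into multiplication. -/
theorem hasMellin_mulConv {K g : ℝ → ℂ} {s : ℂ} (hK : Measurable K)
    (hKs : MellinConvergent K s) (hgs : MellinConvergent g s) :
    HasMellin (mulConv K g) s (mellin K s * mellin g s) := by
  set Q : ℝ → ℂ := fun t => (t : ℂ) ^ (s - 1) • K t
  set G : ℝ → ℂ := fun t => (t : ℂ) ^ (s - 1) • g t
  have hQm : Measurable Q := (by fun_prop : Measurable fun t : ℝ => (t : ℂ) ^ (s - 1)).smul hK
  have hint := integrable_prod_mulConv hQm hKs hgs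
  have e1 : ∀ x ∈ Ioi (0 : ℝ), ∫ y in Ioi (0 : ℝ), (1 / (y : ℂ)) * Q (x / y) * G y
      = (x : ℂ) ^ (s - 1) • mulConv K g x := by
    intro x hx
    rw [mulConv, ← integral_smul]
    refine setIntegral_congr_fun measurableSet_Ioi fun y hy => ?_
    have hxy : (x : ℂ) ^ (s - 1) = ((x / y : ℝ) : ℂ) ^ (s - 1) * (y : ℂ) ^ (s - 1) := by
      rw [← Complex.mul_cpow_ofReal_nonneg (div_pos hx hy).le (le_of_lt hy), ← Complex.ofReal_mul,
        div_mul_cancel₀ _ (ne_of_gt hy)]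
    simp only [Q, G, smul_eq_mul, hxy]
    ring
  constructor
  · exact (hint.integral_prod_left).congr
      ((ae_restrict_mem measurableSet_Ioi).mono fun x hx => e1 x hx)
  · rw [mellin, ← setIntegral_congr_fun measurableSet_Ioi e1, integral_integral_swap hint]
    have e2 : ∀ y ∈ Ioi (0 : ℝ), ∫ x in Ioi (0 : ℝ), (1 / (y : ℂ)) * Q (x / y) * G y
        = mellin K s * G y := by
      intro y hy
      have hy' : 0 < y := hy
      have hyc : (y : ℂ) ≠ 0 := Complex.ofReal_ne_zero.2 hy'.ne'
      have h := integral_comp_mul_right_Ioi Q 0 (inv_pos.2 hy')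
      simp only [div_eq_mul_inv, integral_mul_const, integral_const_mul, h]
      simp only [mellin, Q, zero_mul, inv_inv, Complex.real_smul]
      field_simp
    rw [setIntegral_congr_fun measurableSet_Ioi e2, integral_const_mul]
    rfl

theorem integrableOn_mulConv {K g : ℝ → ℂ} {k C : ℝ} (hK : Measurable K)
    (hC : ∀ x, 0 < x → x ^ k * ‖K x‖ ≤ C) (hg : MellinConvergent g k) {x : ℝ} (hx : 0 < x) :
    IntegrableOn (fun y : ℝ => (1 / (y : ℂ)) * K (x / y) * g y) (Ioi 0) ∧
      x ^ k * ‖mulConv K g x‖ ≤ C * ∫ y in Ioi (0 : ℝ), ‖(y : ℂ) ^ ((k : ℂ) - 1) • g y‖ := by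
  have hb : ∀ y ∈ Ioi (0 : ℝ), ‖(1 / (y : ℂ)) * K (x / y) * g y‖ ≤
      (x ^ k)⁻¹ * (C * ‖(y : ℂ) ^ ((k : ℂ) - 1) • g y‖) := by
    intro y hy
    have hy' : 0 < y := hy
    have h1 := hC (x / y) (div_pos hx hy')
    have hyk : 0 < y ^ k := Real.rpow_pos_of_pos hy' k
    have hxk : 0 < x ^ k := Real.rpow_pos_of_pos hx k
    rw [Real.div_rpow hx.le hy'.le] at h1
    have h2 : ‖K (x / y)‖ ≤ (x ^ k)⁻¹ * C * y ^ k := by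
      rw [div_mul_eq_mul_div, div_le_iff₀ hyk] at h1
      rw [mul_assoc, inv_mul_eq_div, le_div_iff₀ hxk]
      linarith
    rw [norm_smul, Complex.norm_cpow_eq_rpow_re_of_pos hy']
    simp only [norm_mul, norm_div, norm_one, Complex.norm_real, Real.norm_eq_abs, abs_of_pos hy',
      Complex.sub_re, Complex.ofReal_re, Complex.one_re]
    rw [Real.rpow_sub_one hy'.ne']
    calc 1 / y * ‖K (x / y)‖ * ‖g y‖ ≤ 1 / y * ((x ^ k)⁻¹ * C * y ^ k) * ‖g y‖ := by gcongr
      _ = _ := by field_simp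
  have hdom : IntegrableOn (fun y : ℝ => (x ^ k)⁻¹ * (C * ‖(y : ℂ) ^ ((k : ℂ) - 1) • g y‖))
      (Ioi 0) := (hg.norm.const_mul C).const_mul _
  refine ⟨Integrable.mono' hdom ?_ ((ae_restrict_mem measurableSet_Ioi).mono hb), ?_⟩
  · refine AEStronglyMeasurable.mul (Measurable.aestronglyMeasurable ?_) hg.aestronglyMeasurable
    exact (by fun_prop : Measurable fun y : ℝ => 1 / (y : ℂ)).mul (hK.comp (by fun_prop))
  · have h := norm_integral_le_of_norm_le hdom ((ae_restrict_mem measurableSet_Ioi).mono hb)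
    rw [integral_const_mul, integral_const_mul, inv_mul_eq_div,
      le_div_iff₀ (Real.rpow_pos_of_pos hx k)] at h
    rw [mulConv, mul_comm]
    exact h

theorem HasMellin.congr_fun {f g : ℝ → ℂ} {s m : ℂ} (hf : HasMellin f s m)
    (h : f =ᵐ[volume.restrict (Ioi 0)] g) : HasMellin g s m :=
  ⟨hf.1.congr_fun h, (mellin_congr_fun s h).symm.trans hf.2⟩

theorem HasMellin.congr_Ioi {f g : ℝ → ℂ} {s m : ℂ} (hf : HasMellin f s m)
    (h : ∀ t, 0 < t → f t = g t) : HasMellin g s m :=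
  hf.congr_fun ((ae_restrict_mem measurableSet_Ioi).mono fun t ht => h t ht)

theorem HasMellin.cpow_smul {f : ℝ → ℂ} {s a m : ℂ} (hf : HasMellin f (s + a) m) :
    HasMellin (fun t : ℝ => (t : ℂ) ^ a • f t) s m :=
  ⟨MellinConvergent.cpow_smul.2 hf.1, (mellin_cpow_smul f s a).trans hf.2⟩

theorem HasMellin.comp_rpow {f : ℝ → ℂ} {s m : ℂ} {a : ℝ} (ha : a ≠ 0)
    (hf : HasMellin f (s / a) m) : HasMellin (fun t : ℝ => f (t ^ a)) s (|a|⁻¹ • m) :=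
  ⟨(MellinConvergent.comp_rpow ha).2 hf.1, by rw [mellin_comp_rpow, hf.2]⟩

theorem HasMellin.comp_mul_left {f : ℝ → ℂ} {s m : ℂ} {a : ℝ} (ha : 0 < a)
    (hf : HasMellin f s m) : HasMellin (fun t : ℝ => f (a * t)) s ((a : ℂ) ^ (-s) • m) :=
  ⟨(MellinConvergent.comp_mul_left ha).2 hf.1, by rw [mellin_comp_mul_left _ _ ha, hf.2]⟩

theorem sin_pi_mul_ne_zero_of_re_mem_Ioo {z : ℂ} (h0 : 0 < z.re) (h1 : z.re < 1) :
    Complex.sin (Real.pi * z) ≠ 0 := by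
  rw [Ne, Complex.sin_eq_zero_iff]
  rintro ⟨n, hn⟩
  have hz : z = n := by
    have : (Real.pi : ℂ) ≠ 0 := Complex.ofReal_ne_zero.2 Real.pi_ne_zero
    rw [mul_comm] at hn
    exact mul_right_cancel₀ this hn
  rw [hz, Complex.intCast_re] at h0 h1
  have h2 : (0 : ℤ) < n := by exact_mod_cast h0
  have h3 : n < (1 : ℤ) := by exact_mod_cast h1
  omega

theorem hasMellin_exp_neg {s : ℂ} (hs : 0 < s.re) :
    HasMellin (fun t : ℝ => ((Real.exp (-t) : ℝ) : ℂ)) s (Complex.Gamma s) := by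
  constructor
  · exact (Complex.GammaIntegral_convergent hs).congr
      (Filter.Eventually.of_forall fun t => mul_comm _ _)
  · rw [Complex.Gamma_eq_integral hs, Complex.GammaIntegral_eq_mellin]

theorem hasMellin_one_div_one_add {s : ℂ} (hs0 : 0 < s.re) (hs1 : s.re < 1) :
    HasMellin (fun t : ℝ => 1 / (1 + (t : ℂ))) s (Real.pi / Complex.sin (Real.pi * s)) := by
  set K : ℝ → ℂ := fun t => ((Real.exp (-t) : ℝ) : ℂ)
  have hK := hasMellin_exp_neg hs0
  have hg : HasMellin (fun t : ℝ => (t : ℂ) ^ (-1 : ℂ) • K (t ^ (-1 : ℝ))) s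
      (Complex.Gamma (1 - s)) := by
    have h1 : HasMellin K ((s + -1) / ((-1 : ℝ) : ℂ)) (Complex.Gamma (1 - s)) := by
      convert! hasMellin_exp_neg (s := 1 - s) (by simpa using hs1) using 1
      push_cast
      ring
    simpa using (h1.comp_rpow (by norm_num)).cpow_smul
  have h := hasMellin_mulConv (K := K) (by fun_prop) hK.1 hg.1
  rw [hK.2, hg.2, Complex.Gamma_mul_Gamma_one_sub] at h
  refine h.congr_Ioi fun x hx => ?_
  have hr : (0 : ℝ) < x + 1 := by linarith
  have h2 := Complex.integral_cpow_mul_exp_neg_mul_Ioi (a := 1) (r := x + 1) (by simp) hr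
  have h3 := mellin_comp_inv (fun t : ℝ => Complex.exp (-((x + 1 : ℝ) : ℂ) * t)) (-1)
  rw [neg_neg, mellin, mellin] at h3
  simp only [neg_mul, smul_eq_mul] at h2 h3
  rw [h2] at h3
  have h4 : mulConv K (fun t : ℝ => (t : ℂ) ^ (-1 : ℂ) • K (t ^ (-1 : ℝ))) x =
      (1 / ((x + 1 : ℝ) : ℂ)) ^ (1 : ℂ) * Complex.Gamma 1 := by
    rw [← h3]
    refine setIntegral_congr_fun measurableSet_Ioi fun y hy => ?_
    have hy' : (y : ℂ) ≠ 0 := Complex.ofReal_ne_zero.2 (ne_of_gt hy)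
    simp only [K, smul_eq_mul, Complex.ofReal_exp, Real.rpow_neg_one]
    rw [Complex.cpow_sub _ _ hy', Complex.cpow_neg_one, Complex.cpow_one]
    have : Complex.exp (-(((x + 1 : ℝ) : ℂ) * ((y⁻¹ : ℝ) : ℂ))) =
        Complex.exp ((-(x / y) : ℝ) : ℂ) * Complex.exp ((-y⁻¹ : ℝ) : ℂ) := by
      rw [← Complex.exp_add]
      congr 1
      push_cast
      ring
    rw [this]
    field_simp
  rw [h4]
  simp [add_comm]

/-- The kernel `t ^ a / (1 + t ^ 2)`. -/
def cpowKernel (a : ℂ) (t : ℝ) : ℂ := (t : ℂ) ^ a / (1 + (t : ℂ) ^ 2)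

theorem measurable_cpowKernel (a : ℂ) : Measurable (cpowKernel a) := by
  unfold cpowKernel
  fun_prop

theorem hasMellin_cpowKernel {a s : ℂ} (h0 : 0 < (s + a).re) (h2 : (s + a).re < 2) :
    HasMellin (cpowKernel a) s (Real.pi / 2 / Complex.sin (Real.pi * ((s + a) / 2))) := by
  have hre : ((s + a) / ((2 : ℝ) : ℂ)).re = (s + a).re / 2 := by
    rw [Complex.div_ofReal_re]
  have h := ((hasMellin_one_div_one_add (s := (s + a) / ((2 : ℝ) : ℂ)) (by rw [hre]; linarith)
    (by rw [hre]; linarith)).comp_rpow two_ne_zero).cpow_smul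
  convert! h.congr_Ioi (g := cpowKernel a) ?_ using 1
  · simp
    ring
  · intro t ht
    simp [cpowKernel, div_eq_mul_inv]

/-- The function `v ↦ 1 / ((v ^ 2 + u ^ 2) (1 + v ^ 2))`. -/
def quarticKernel (u v : ℝ) : ℂ := 1 / (((v : ℂ) ^ 2 + (u : ℂ) ^ 2) * (1 + (v : ℂ) ^ 2))

theorem sq_add_sq_ne_zero_of_pos {u : ℝ} (hu : 0 < u) (v : ℝ) : (v : ℂ) ^ 2 + (u : ℂ) ^ 2 ≠ 0 := by
  have : v ^ 2 + u ^ 2 ≠ 0 := by positivity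
  exact_mod_cast this

theorem one_add_sq_ne_zero (v : ℝ) : 1 + (v : ℂ) ^ 2 ≠ 0 := by
  have : 1 + v ^ 2 ≠ 0 := by positivity
  exact_mod_cast this

theorem mulConv_cpowKernel (α : ℂ) {u : ℝ} (hu : 0 < u) :
    mulConv (cpowKernel (2 - α)) (cpowKernel (1 + α)) u =
      (u : ℂ) ^ (2 - α) * mellin (quarticKernel u) (2 * α + 1) := by
  rw [mulConv, mellin, ← integral_const_mul]
  refine setIntegral_congr_fun measurableSet_Ioi fun v hv => ?_
  have hv' : (v : ℂ) ≠ 0 := Complex.ofReal_ne_zero.2 (ne_of_gt hv)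
  have h1 := sq_add_sq_ne_zero_of_pos hu v
  have h2 := one_add_sq_ne_zero v
  have h3 : ((u / v : ℝ) : ℂ) ^ (2 - α) = (u : ℂ) ^ (2 - α) * ((v : ℂ) ^ (2 - α))⁻¹ := by
    rw [div_eq_mul_inv, Complex.ofReal_mul, Complex.mul_cpow_ofReal_nonneg hu.le
      (inv_pos.2 hv).le, Complex.ofReal_inv, Complex.inv_cpow]
    rw [Complex.arg_ofReal_of_nonneg (le_of_lt hv)]
    exact Real.pi_pos.ne
  have h4 : (v : ℂ) ^ (2 * α + 1 - 1) = (v : ℂ) ^ α * (v : ℂ) ^ α := by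
    rw [← Complex.cpow_add _ _ hv']
    congr 1
    ring
  have h5 : 1 + ((u : ℂ) / v) ^ 2 ≠ 0 := by
    rw [div_pow, ← div_self (pow_ne_zero 2 hv'), ← add_div]
    exact div_ne_zero h1 (pow_ne_zero 2 hv')
  have h6 : (v : ℂ) ^ α ≠ 0 := by simp [Complex.cpow_eq_zero_iff, hv']
  simp only [cpowKernel, quarticKernel, h3, h4, smul_eq_mul]
  rw [Complex.cpow_add _ _ hv', Complex.cpow_sub _ _ hv', Complex.cpow_one, Complex.cpow_ofNat,
    Complex.ofReal_div]
  have h7 : 1 + ((u : ℂ) / v) ^ 2 = ((v : ℂ) ^ 2 + (u : ℂ) ^ 2) / (v : ℂ) ^ 2 := by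
    field_simp
  rw [h7]
  field_simp

theorem differentiableAt_mellin_quarticKernel {u : ℝ} (hu : 0 < u) {s : ℂ} (h0 : 0 < s.re)
    (h4 : s.re < 4) : DifferentiableAt ℂ (mellin (quarticKernel u)) s := by
  have hcont : Continuous (quarticKernel u) := by
    unfold quarticKernel
    refine Continuous.div (by fun_prop) (by fun_prop) fun v =>
      mul_ne_zero (sq_add_sq_ne_zero_of_pos hu v) (one_add_sq_ne_zero v)
  have hnorm : ∀ v, ‖quarticKernel u v‖ = 1 / ((v ^ 2 + u ^ 2) * (1 + v ^ 2)) := by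
    intro v
    have : quarticKernel u v = ((1 / ((v ^ 2 + u ^ 2) * (1 + v ^ 2)) : ℝ) : ℂ) := by
      simp [quarticKernel]
    rw [this, Complex.norm_real, Real.norm_eq_abs, abs_of_pos (by positivity)]
  refine mellin_differentiableAt_of_isBigO_rpow (a := 4) (b := 0)
    (hcont.continuousOn.locallyIntegrableOn measurableSet_Ioi) ?_ h4 ?_ h0
  · refine IsBigO.of_bound 1 ((Filter.eventually_gt_atTop 0).mono fun v hv => ?_)
    rw [hnorm, Real.norm_eq_abs, abs_of_pos (Real.rpow_pos_of_pos hv _), one_mul,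
      Real.rpow_neg hv.le, one_div]
    gcongr
    norm_num
    nlinarith [sq_nonneg (u * v), sq_nonneg u, sq_nonneg v]
  · simp only [neg_zero, Real.rpow_zero]
    exact ((hcont.tendsto 0).isBigO_one ℝ).mono nhdsWithin_le_nhds

theorem mellin_quarticKernel_of_re_lt_half {u : ℝ} (hu : 0 < u) {β : ℂ} (h0 : 0 < β.re)
    (h1 : β.re < 1 / 2) :
    Complex.cos (Real.pi * β) * mellin (quarticKernel u) (2 * β + 1) * (1 - (u : ℂ) ^ 2) =
      Real.pi / 2 * ((u : ℂ) ^ (2 * β - 1) - 1) := by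
  have hu' : (u : ℂ) ≠ 0 := Complex.ofReal_ne_zero.2 hu.ne'
  have hre : (2 * β + 1 + 0).re = 2 * β.re + 1 := by simp
  have hA := hasMellin_cpowKernel (a := 0) (s := 2 * β + 1) (by rw [hre]; linarith)
    (by rw [hre]; linarith)
  have hB := hasMellin_const_smul (hA.comp_mul_left (inv_pos.2 hu)).1 (((u : ℂ) ^ 2)⁻¹)
  rw [(hA.comp_mul_left (inv_pos.2 hu)).2] at hB
  have hC := hasMellin_sub hB.1 hA.1
  rw [hB.2, hA.2] at hC
  have hD := hC.congr_Ioi (g := fun v => (1 - (u : ℂ) ^ 2) • quarticKernel u v) (by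
    intro v hv
    have g1 := sq_add_sq_ne_zero_of_pos hu v
    have g2 := one_add_sq_ne_zero v
    have g3 : 1 + (((u⁻¹ * v : ℝ) : ℂ)) ^ 2 = ((v : ℂ) ^ 2 + (u : ℂ) ^ 2) / (u : ℂ) ^ 2 := by
      push_cast
      field_simp
      ring
    simp only [cpowKernel, quarticKernel, Complex.cpow_zero, g3, smul_eq_mul]
    field_simp
    ring)
  have hE := hD.2
  rw [mellin_const_smul, smul_eq_mul] at hE
  rw [mul_assoc, mul_comm (mellin _ _), hE]
  have hsin : Complex.sin (Real.pi * ((2 * β + 1 + 0) / 2)) = Complex.cos (Real.pi * β) := by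
    rw [← Complex.sin_add_pi_div_two]
    congr 1
    ring
  have hcos : Complex.cos (Real.pi * β) ≠ 0 := by
    rw [← hsin]
    refine sin_pi_mul_ne_zero_of_re_mem_Ioo ?_ ?_ <;> simp <;> linarith
  have hpow : ((u⁻¹ : ℝ) : ℂ) ^ (-(2 * β + 1)) = (u : ℂ) ^ (2 * β - 1) * (u : ℂ) ^ 2 := by
    rw [Complex.ofReal_inv, Complex.inv_cpow _ _ (by
      rw [Complex.arg_ofReal_of_nonneg hu.le]; exact Real.pi_pos.ne), ← Complex.cpow_neg,
      ← Complex.cpow_ofNat, ← Complex.cpow_add _ _ hu']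
    congr 1
    ring
  rw [hsin, hpow]
  simp only [smul_eq_mul]
  field_simp

theorem mellin_quarticKernel {u : ℝ} (hu : 0 < u) {β : ℂ} (h0 : 0 < β.re) (h1 : β.re < 1) :
    Complex.cos (Real.pi * β) * mellin (quarticKernel u) (2 * β + 1) * (1 - (u : ℂ) ^ 2) =
      Real.pi / 2 * ((u : ℂ) ^ (2 * β - 1) - 1) := by
  have hu' : (u : ℂ) ≠ 0 := Complex.ofReal_ne_zero.2 hu.ne'
  set U : Set ℂ := {z | 0 < z.re} ∩ {z | z.re < 1}
  have hUo : IsOpen U := (isOpen_lt continuous_const Complex.continuous_re).inter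
    (isOpen_lt Complex.continuous_re continuous_const)
  have hUc : IsPreconnected U :=
    ((convex_halfSpace_re_gt 0).inter (convex_halfSpace_re_lt 1)).isPreconnected
  have hf : DifferentiableOn ℂ (fun z : ℂ => Complex.cos (Real.pi * z) *
      mellin (quarticKernel u) (2 * z + 1) * (1 - (u : ℂ) ^ 2)) U := by
    intro z hz
    have hd : DifferentiableAt ℂ (mellin (quarticKernel u)) (2 * z + 1) :=
      differentiableAt_mellin_quarticKernel hu (by have := hz.1; simp at this ⊢; linarith)
        (by have := hz.2; simp at this ⊢; linarith)
    have hd' : DifferentiableAt ℂ (fun z : ℂ => mellin (quarticKernel u) (2 * z + 1)) z :=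
      DifferentiableAt.comp (g := mellin (quarticKernel u)) (f := fun z => 2 * z + 1) z hd
        (by fun_prop)
    exact (((by fun_prop : DifferentiableAt ℂ (fun z : ℂ => Complex.cos (Real.pi * z)) z).mul
      hd').mul_const _).differentiableWithinAt
  have hg : DifferentiableOn ℂ (fun z : ℂ => Real.pi / 2 * ((u : ℂ) ^ (2 * z - 1) - 1)) U := by
    intro z _
    have hd : DifferentiableAt ℂ (fun z : ℂ => (u : ℂ) ^ (2 * z - 1)) z :=
      (by fun_prop : DifferentiableAt ℂ (fun z : ℂ => 2 * z - 1) z).const_cpow (Or.inl hu')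
    exact ((hd.sub_const 1).const_mul _).differentiableWithinAt
  have hquarter : (1 / 4 : ℂ) ∈ U := by constructor <;> norm_num [U]
  refine (hf.analyticOnNhd hUo).eqOn_of_preconnected_of_eventuallyEq (hg.analyticOnNhd hUo) hUc
    hquarter ?_ (⟨h0, h1⟩ : β ∈ U)
  have hV : IsOpen ({z : ℂ | 0 < z.re} ∩ {z | z.re < 1 / 2}) :=
    (isOpen_lt continuous_const Complex.continuous_re).inter
      (isOpen_lt Complex.continuous_re continuous_const)
  filter_upwards [hV.mem_nhds (x := (1 / 4 : ℂ)) (by constructor <;> norm_num)] with z hz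
  exact mellin_quarticKernel_of_re_lt_half hu hz.1 hz.2

theorem mellin_quarticKernel_two {u : ℝ} (hu : 0 < u) :
    mellin (quarticKernel u) 2 * (1 - (u : ℂ) ^ 2) = -(Real.log u : ℂ) := by
  have hu' : (u : ℂ) ≠ 0 := Complex.ofReal_ne_zero.2 hu.ne'
  have hpi : (Real.pi : ℂ) ≠ 0 := Complex.ofReal_ne_zero.2 Real.pi_ne_zero
  have hd : DifferentiableAt ℂ (mellin (quarticKernel u)) (2 * (1 / 2) + 1) :=
    differentiableAt_mellin_quarticKernel hu (by norm_num) (by norm_num)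
  have hlin : HasDerivAt (fun z : ℂ => 2 * z + 1) 2 (1 / 2) := by
    simpa using ((hasDerivAt_id (1 / 2 : ℂ)).const_mul 2).add_const 1
  have hlin' : HasDerivAt (fun z : ℂ => 2 * z - 1) 2 (1 / 2) := by
    simpa using ((hasDerivAt_id (1 / 2 : ℂ)).const_mul 2).sub_const 1
  have hcos : HasDerivAt (fun z : ℂ => Complex.cos (Real.pi * z))
      (-Complex.sin (Real.pi * (1 / 2)) * (Real.pi * 1)) (1 / 2) :=
    ((hasDerivAt_id (1 / 2 : ℂ)).const_mul (Real.pi : ℂ)).ccos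
  have hL := (hcos.mul (hd.hasDerivAt.comp (1 / 2) hlin)).mul_const (1 - (u : ℂ) ^ 2)
  have hR := ((hlin'.const_cpow (c := (u : ℂ)) (Or.inl hu')).sub_const 1).const_mul
    (Real.pi / 2 : ℂ)
  have hV : IsOpen ({z : ℂ | 0 < z.re} ∩ {z | z.re < 1}) :=
    (isOpen_lt continuous_const Complex.continuous_re).inter
      (isOpen_lt Complex.continuous_re continuous_const)
  have heq := hL.unique (hR.congr_of_eventuallyEq (by
    filter_upwards [hV.mem_nhds (x := (1 / 2 : ℂ)) (by constructor <;> norm_num)] with z hz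
    exact mellin_quarticKernel hu hz.1 hz.2))
  have e1 : (Real.pi : ℂ) * (1 / 2) = Real.pi / 2 := by ring
  have e2 : (2 : ℂ) * (1 / 2) + 1 = 2 := by norm_num
  have e3 : (2 : ℂ) * (1 / 2) - 1 = 0 := by norm_num
  simp only [Function.comp_apply, e1, e2, e3, Complex.sin_pi_div_two, Complex.cos_pi_div_two,
    Complex.cpow_zero, zero_mul, add_zero, mul_one, one_mul, ← Complex.ofReal_log hu.le] at heq
  refine mul_left_cancel₀ (neg_ne_zero.2 hpi) ?_
  linear_combination heq

theorem rpow_mul_norm_cpowKernel_le {a : ℂ} {k : ℝ} (h0 : 0 ≤ k + a.re) (h2 : k + a.re ≤ 2)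
    {x : ℝ} (hx : 0 < x) : x ^ k * ‖cpowKernel a x‖ ≤ 1 := by
  have hn : ‖(1 : ℂ) + (x : ℂ) ^ 2‖ = 1 + x ^ 2 := by
    have : (1 : ℂ) + (x : ℂ) ^ 2 = ((1 + x ^ 2 : ℝ) : ℂ) := by simp
    rw [this, Complex.norm_real, Real.norm_eq_abs, abs_of_pos (by positivity)]
  rw [cpowKernel, norm_div, hn, Complex.norm_cpow_eq_rpow_re_of_pos hx, ← mul_div_assoc,
    ← Real.rpow_add hx, div_le_one (by positivity)]
  rcases le_total x 1 with h | h
  · exact (Real.rpow_le_one hx.le h h0).trans (by nlinarith)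
  · refine (Real.rpow_le_rpow_of_exponent_le h h2).trans ?_
    rw [Real.rpow_two]
    linarith

theorem sin_pi_sub_sin_pi (s α : ℂ) :
    Complex.sin (Real.pi * s) - Complex.sin (Real.pi * α) =
      -2 * Complex.sin (Real.pi * ((s + (2 - α)) / 2)) *
        Complex.sin (Real.pi * ((s + (1 + α)) / 2)) := by
  have e1 : (Real.pi : ℂ) * ((s + (2 - α)) / 2) = (Real.pi * s - Real.pi * α) / 2 + Real.pi := by
    ring
  have e2 : (Real.pi : ℂ) * ((s + (1 + α)) / 2) =
      (Real.pi * s + Real.pi * α) / 2 + Real.pi / 2 := by ring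
  rw [e1, e2, Complex.sin_add_pi, Complex.sin_add_pi_div_two, Complex.sin_sub_sin]
  ring

theorem sin_sub_sin_ne_zero {α s : ℂ} (h0 : 0 < s.re) (h1 : s.re < α.re) (h2 : α.re ≤ 1 / 2) :
    Complex.sin (Real.pi * s) - Complex.sin (Real.pi * α) ≠ 0 := by
  have hA : Complex.sin (Real.pi * ((s + (2 - α)) / 2)) ≠ 0 := by
    refine sin_pi_mul_ne_zero_of_re_mem_Ioo ?_ ?_ <;> simp <;> linarith
  have hB : Complex.sin (Real.pi * ((s + (1 + α)) / 2)) ≠ 0 := by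
    refine sin_pi_mul_ne_zero_of_re_mem_Ioo ?_ ?_ <;> simp <;> linarith
  rw [sin_pi_sub_sin_pi]
  exact mul_ne_zero (mul_ne_zero (by norm_num) hA) hB

theorem measurable_r3 (α : ℂ) : Measurable (r3 α) := by
  unfold r3 r2 r1
  split_ifs <;> fun_prop

theorem r3_one (α : ℂ) : r3 α 1 = 0 := by
  unfold r3 r2 r1
  split_ifs <;> simp

theorem r3_eq_mulConv {α : ℂ} (hα1 : 0 < α.re) (hα2 : α.re ≤ 1 / 2) {u : ℝ} (hu : 0 < u)
    (hu1 : u ≠ 1) :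
    r3 α u = -(2 / Real.pi) * mulConv (cpowKernel (2 - α)) (cpowKernel (1 + α)) u := by
  have hu' : (u : ℂ) ≠ 0 := Complex.ofReal_ne_zero.2 hu.ne'
  have hpi : (Real.pi : ℂ) ≠ 0 := Complex.ofReal_ne_zero.2 Real.pi_ne_zero
  have hden : 1 - (u : ℂ) ^ 2 ≠ 0 := by
    have : 1 - u ^ 2 ≠ 0 := by
      have h : (1 - u) * (1 + u) ≠ 0 := mul_ne_zero (sub_ne_zero.2 hu1.symm) (by positivity)
      intro h'
      exact h (by linear_combination h')
    exact_mod_cast this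
  rw [mulConv_cpowKernel α hu]
  by_cases hα : α = 1 / 2
  · subst hα
    have h := mellin_quarticKernel_two hu
    have e : (2 : ℂ) * (1 / 2) + 1 = 2 := by norm_num
    have e2 : (u : ℂ) ^ (2 - 1 / 2 : ℂ) = u * (u : ℂ) ^ (1 / 2 : ℂ) := by
      rw [show (2 - 1 / 2 : ℂ) = 1 + 1 / 2 by norm_num, Complex.cpow_add _ _ hu', Complex.cpow_one]
    rw [e, e2, eq_div_of_mul_eq hden h]
    simp only [r3, r2, r1, if_true]
    field_simp
  · have hcos : Complex.cos (Real.pi * α) ≠ 0 := by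
      intro h0
      rw [Complex.cos_eq_zero_iff] at h0
      obtain ⟨n, hn⟩ := h0
      have hz : α = ((2 * n + 1) / 2 : ℂ) :=
        mul_left_cancel₀ hpi (by rw [hn]; ring)
      have hzr : α.re = (2 * n + 1) / 2 := by
        rw [hz, show ((2 * n + 1) / 2 : ℂ) = (((2 * n + 1) / 2 : ℝ) : ℂ) by push_cast; rfl,
          Complex.ofReal_re]
      have h3 : (-1 : ℝ) < n := by linarith
      have h4 : (n : ℝ) ≤ 0 := by linarith
      have h5 : -1 < n := by exact_mod_cast h3
      have h6 : n ≤ 0 := by exact_mod_cast h4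
      have h7 : n = 0 := by omega
      apply hα
      rw [hz, h7]
      simp
    have h := mellin_quarticKernel hu hα1 (by linarith)
    have hm : mellin (quarticKernel u) (2 * α + 1) =
        Real.pi / 2 * ((u : ℂ) ^ (2 * α - 1) - 1) / (1 - (u : ℂ) ^ 2) /
          Complex.cos (Real.pi * α) := by
      rw [eq_div_iff hcos, eq_div_iff hden, ← h]
      ring
    have hne : -α ≠ -(1 / 2 : ℂ) := fun h' => hα (neg_injective h')
    have e1 : (u : ℂ) ^ (-α + 1) * u = (u : ℂ) ^ (2 - α) := by
      nth_rewrite 2 [← Complex.cpow_one (u : ℂ)]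
      rw [← Complex.cpow_add _ _ hu']
      congr 1
      ring
    have e2 : (u : ℂ) ^ α * u = (u : ℂ) ^ (2 - α) * (u : ℂ) ^ (2 * α - 1) := by
      nth_rewrite 2 [← Complex.cpow_one (u : ℂ)]
      rw [← Complex.cpow_add _ _ hu', ← Complex.cpow_add _ _ hu']
      congr 1
      ring
    rw [hm]
    generalize (u : ℂ) ^ (2 * α - 1) = p at e2 ⊢
    simp only [r3, r2, r1, if_neg hne, neg_neg, mul_neg, Complex.cos_neg]
    field_simp
    linear_combination e1 - e2

theorem hasMellin_r3 {α s : ℂ} (h0 : 0 < s.re) (h1 : s.re < α.re) (h2 : α.re ≤ 1 / 2) :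
    HasMellin (r3 α) s
      (Real.pi / (Complex.sin (Real.pi * s) - Complex.sin (Real.pi * α))) := by
  have hpi : (Real.pi : ℂ) ≠ 0 := Complex.ofReal_ne_zero.2 Real.pi_ne_zero
  have hA := hasMellin_cpowKernel (a := 2 - α) (s := s) (by simp; linarith) (by simp; linarith)
  have hB := hasMellin_cpowKernel (a := 1 + α) (s := s) (by simp; linarith) (by simp; linarith)
  have h := hasMellin_mulConv (measurable_cpowKernel _) hA.1 hB.1
  have h' := hasMellin_const_smul h.1 (-(2 / Real.pi) : ℂ)
  rw [h.2, hA.2, hB.2] at h'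
  have hne := sin_sub_sin_ne_zero h0 h1 h2
  rw [sin_pi_sub_sin_pi] at hne ⊢
  convert h'.congr_fun ?_ using 1
  · have hA' := right_ne_zero_of_mul (left_ne_zero_of_mul hne)
    have hB' := right_ne_zero_of_mul hne
    rw [smul_eq_mul]
    field_simp
  · have hone : ∀ᵐ x ∂(volume.restrict (Ioi (0 : ℝ))), x ≠ 1 :=
      ae_restrict_of_ae (Measure.ae_ne volume 1)
    filter_upwards [ae_restrict_mem measurableSet_Ioi, hone] with x hx hx1
    rw [r3_eq_mulConv (h0.trans h1) h2 hx hx1, smul_eq_mul]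

theorem exists_rpow_mul_norm_r3_le {α : ℂ} {k : ℝ} (hk : 0 < k) (hkα : k < α.re)
    (hα : α.re ≤ 1 / 2) : ∃ C, ∀ x, 0 < x → x ^ k * ‖r3 α x‖ ≤ C := by
  have hB := hasMellin_cpowKernel (a := 1 + α) (s := (k : ℂ)) (by simp; linarith)
    (by simp; linarith)
  have hb := fun x (hx : 0 < x) => (integrableOn_mulConv (k := k) (measurable_cpowKernel (2 - α))
    (fun x hx => rpow_mul_norm_cpowKernel_le (by simp; linarith) (by simp; linarith) hx)
    hB.1 hx).2
  set I := ∫ y in Ioi (0 : ℝ), ‖(y : ℂ) ^ ((k : ℂ) - 1) • cpowKernel (1 + α) y‖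
  refine ⟨‖(-(2 / Real.pi) : ℂ)‖ * (1 * I), fun x hx => ?_⟩
  have hI : 0 ≤ I := integral_nonneg fun y => norm_nonneg _
  by_cases hx1 : x = 1
  · rw [hx1, r3_one, norm_zero, mul_zero]
    positivity
  · rw [r3_eq_mulConv (hk.trans hkα) hα hx hx1, norm_mul, mul_left_comm]
    exact mul_le_mul_of_nonneg_left (hb x hx) (norm_nonneg _)

theorem MemEk.mellinConvergent {k : ℝ} {f : ℝ → ℂ} (hf : MemEk k f) : MellinConvergent f k := by
  refine IntegrableOn.congr_fun hf (fun x hx => ?_) measurableSet_Ioi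
  simp only [Complex.real_smul, smul_eq_mul]
  rw [Complex.ofReal_cpow (le_of_lt hx)]
  push_cast
  rfl

/-- The Stieltjes kernel written as a multiplicative convolution kernel. -/
theorem stieltjes_integrand_eq (f : ℝ → ℂ) {x y : ℝ} (hx : 0 < x) (hy : 0 < y) :
    (1 / (y : ℂ)) * (1 / (1 + ((x / y : ℝ) : ℂ))) * f y = f y / ((x : ℂ) + (y : ℂ)) := by
  have hy' : (y : ℂ) ≠ 0 := Complex.ofReal_ne_zero.2 hy.ne'
  have hxy : (x : ℂ) + (y : ℂ) ≠ 0 := by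
    have : x + y ≠ 0 := by positivity
    exact_mod_cast this
  have h : 1 + ((x / y : ℝ) : ℂ) = ((x : ℂ) + (y : ℂ)) / y := by
    push_cast
    field_simp
    ring
  rw [h]
  field_simp

theorem rpow_mul_norm_one_div_one_add_le {k : ℝ} (h0 : 0 ≤ k) (h1 : k ≤ 1) {x : ℝ} (hx : 0 < x) :
    x ^ k * ‖1 / (1 + (x : ℂ))‖ ≤ 1 := by
  have hn : ‖(1 : ℂ) + (x : ℂ)‖ = 1 + x := by
    have : (1 : ℂ) + (x : ℂ) = ((1 + x : ℝ) : ℂ) := by simp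
    rw [this, Complex.norm_real, Real.norm_eq_abs, abs_of_pos (by positivity)]
  rw [norm_div, norm_one, hn, ← mul_div_assoc, mul_one, div_le_one (by positivity)]
  rcases le_total x 1 with h | h
  · exact (Real.rpow_le_one hx.le h h0).trans (by linarith)
  · refine (Real.rpow_le_rpow_of_exponent_le h h1).trans ?_
    rw [Real.rpow_one]
    linarith

/-- An equation `f = g + c u` between functions with convergent Mellin integrals may be checked on
Mellin transforms along a vertical line. -/
theorem ae_eq_add_mul_iff_mellin {f g u : ℝ → ℂ} {k : ℝ} (c : ℂ)
    (hf : ∀ s : ℂ, s.re = k → MellinConvergent f s)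
    (hg : ∀ s : ℂ, s.re = k → MellinConvergent g s)
    (hu : ∀ s : ℂ, s.re = k → MellinConvergent u s) :
    (∀ᵐ x ∂(volume.restrict (Ioi (0 : ℝ))), f x = g x + c * u x) ↔
      ∀ s : ℂ, s.re = k → mellin f s = mellin g s + c * mellin u s := by
  have hD : ∀ s : ℂ, s.re = k → HasMellin (fun x => f x - (g x + c • u x)) s
      (mellin f s - (mellin g s + c * mellin u s)) := by
    intro s hs
    have h1 := hasMellin_const_smul (hu s hs) c
    have h2 := hasMellin_add (hg s hs) h1.1
    have h3 := hasMellin_sub (hf s hs) h2.1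
    rwa [h2.2, h1.2] at h3
  constructor
  · intro h s hs
    have h1 := mellin_congr_fun s (f := fun x => f x - (g x + c • u x)) (g := fun _ => 0)
      (h.mono fun x hx => by simp [hx])
    rw [(hD s hs).2] at h1
    refine sub_eq_zero.1 (h1.trans ?_)
    simp [mellin]
  · intro h
    have h1 := ae_eq_zero_of_mellin_eq_zero (k := k) (hD k (by simp)).1 fun s hs => by
      rw [(hD s hs).2, h s hs, sub_self]
    exact h1.mono fun x hx => by simpa using sub_eq_zero.1 hx

/-- Proposition 1, kernel `R₃`: for `0 < Re α ≤ 1/2`,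
`0 < k < Re α`, `λ = sin(πα)/π` and `g ∈ E_k`, a function `f ∈ E_k`
satisfies the Stieltjes equation a.e. iff `f = g + λ R₃ g` a.e. -/
theorem stmt8 (α : ℂ) (hα1 : 0 < α.re) (hα2 : α.re ≤ 1/2)
    (k : ℝ) (hk1 : 0 < k) (hk2 : k < α.re)
    (lam : ℂ) (hlam : lam = Complex.sin ((Real.pi : ℂ) * α) / (Real.pi : ℂ))
    (g : ℝ → ℂ) (hg : MemEk k g) (f : ℝ → ℂ) (hf : MemEk k f) :
    ((∀ x : ℝ, 0 < x → IntegrableOn (fun y : ℝ => f y / ((x : ℂ) + (y : ℂ))) (Ioi 0)) ∧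
      (∀ᵐ x ∂(volume.restrict (Ioi (0 : ℝ))),
        f x = g x + lam * ∫ y in Ioi (0 : ℝ), f y / ((x : ℂ) + (y : ℂ))))
    ↔
    ((∀ x : ℝ, 0 < x → IntegrableOn (fun y : ℝ => R3 α x y * g y) (Ioi 0)) ∧
      (∀ᵐ x ∂(volume.restrict (Ioi (0 : ℝ))),
        f x = g x + lam * ∫ y in Ioi (0 : ℝ), R3 α x y * g y)) := by
  subst hlam
  have hk12 : k < 1 / 2 := hk2.trans_le hα2
  have hfs : ∀ s : ℂ, s.re = k → MellinConvergent f s := fun s hs =>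
    hf.mellinConvergent.congr_re (by simpa using hs)
  have hgs : ∀ s : ℂ, s.re = k → MellinConvergent g s := fun s hs =>
    hg.mellinConvergent.congr_re (by simpa using hs)
  have hSm : Measurable fun t : ℝ => 1 / (1 + (t : ℂ)) := by fun_prop
  have hS : ∀ s : ℂ, s.re = k → HasMellin (mulConv (fun t : ℝ => 1 / (1 + (t : ℂ))) f) s
      (Real.pi / Complex.sin (Real.pi * s) * mellin f s) := by
    intro s hs
    have h := hasMellin_one_div_one_add (s := s) (by linarith) (by linarith)
    simpa only [h.2] using hasMellin_mulConv hSm h.1 (hfs s hs)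
  have hR : ∀ s : ℂ, s.re = k → HasMellin (mulConv (r3 α) g) s
      (Real.pi / (Complex.sin (Real.pi * s) - Complex.sin (Real.pi * α)) * mellin g s) := by
    intro s hs
    have h := hasMellin_r3 (α := α) (s := s) (by linarith) (by linarith) hα2
    simpa only [h.2] using hasMellin_mulConv (measurable_r3 α) h.1 (hgs s hs)
  obtain ⟨C, hC⟩ := exists_rpow_mul_norm_r3_le hk1 hk2 hα2
  have hSint : ∀ x : ℝ, 0 < x →
      IntegrableOn (fun y : ℝ => f y / ((x : ℂ) + (y : ℂ))) (Ioi 0) := fun x hx =>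
    ((integrableOn_mulConv hSm (fun x hx => rpow_mul_norm_one_div_one_add_le hk1.le
      (by linarith) hx) hf.mellinConvergent hx).1).congr_fun
        (fun y hy => stieltjes_integrand_eq f hx hy) measurableSet_Ioi
  have hRint : ∀ x : ℝ, 0 < x → IntegrableOn (fun y : ℝ => R3 α x y * g y) (Ioi 0) :=
    fun x hx => (integrableOn_mulConv (measurable_r3 α) hC hg.mellinConvergent hx).1
  have hSeq : (∀ᵐ x ∂(volume.restrict (Ioi (0 : ℝ))), f x = g x +
        Complex.sin (Real.pi * α) / Real.pi * ∫ y in Ioi (0 : ℝ), f y / ((x : ℂ) + (y : ℂ))) ↔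
      ∀ᵐ x ∂(volume.restrict (Ioi (0 : ℝ))), f x = g x +
        Complex.sin (Real.pi * α) / Real.pi * mulConv (fun t : ℝ => 1 / (1 + (t : ℂ))) f x := by
    refine Filter.eventually_congr ((ae_restrict_mem measurableSet_Ioi).mono fun x hx => ?_)
    rw [mulConv, setIntegral_congr_fun measurableSet_Ioi
      fun y hy => stieltjes_integrand_eq f hx hy]
  rw [and_iff_right hSint, and_iff_right hRint, hSeq,
    ae_eq_add_mul_iff_mellin _ hfs hgs fun s hs => (hS s hs).1]
  refine Iff.trans ?_ (ae_eq_add_mul_iff_mellin _ hfs hgs fun s hs => (hR s hs).1).symm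
  refine forall₂_congr fun s hs => ?_
  rw [(hS s hs).2, (hR s hs).2]
  have hpi : (Real.pi : ℂ) ≠ 0 := Complex.ofReal_ne_zero.2 Real.pi_ne_zero
  have hq : Complex.sin (Real.pi * s) ≠ 0 :=
    sin_pi_mul_ne_zero_of_re_mem_Ioo (by linarith) (by linarith)
  have hqp := sin_sub_sin_ne_zero (α := α) (s := s) (by linarith) (by linarith) hα2
  field_simp
  constructor <;> intro h <;> linear_combination h

end
end

section
/- (Theorem 1(i)) Let α ∈ ℂ with -1/2 < Re α < 0, set λ = sin(πα)/π (so Re λ < 0 and λ ≠ -1/π), and let g ∈ E. Then f ∈ E satisfies the Stieltjes equation f(x) = g(x) + λ ∫₀^∞ f(y)/(x+y) dy for almost every x > 0 if and only if f(x) = g(x) + (tan(πα)/π)·x·∫₀^∞ ((y/x)^{-α} − (y/x)^{α+1})/(x² − y²)·g(y) dy for almost every x > 0, where the latter integral is absolutely convergent for every x > 0. -/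
open MeasureTheory Set Asymptotics

noncomputable section

theorem cpow_sub_one {x : ℂ} (hx : x ≠ 0) (q : ℂ) : x ^ (q - 1) = x ^ q / x := by
  rw [Complex.cpow_sub _ _ hx, Complex.cpow_one]

theorem cpow_add_one {x : ℂ} (hx : x ≠ 0) (q : ℂ) : x ^ (q + 1) = x ^ q * x := by
  rw [Complex.cpow_add _ _ hx, Complex.cpow_one]

theorem Complex.betaIntegral_one_sub_self {s : ℂ} (h0 : 0 < s.re) (h1 : s.re < 1) :
    Complex.betaIntegral (1 - s) s = Real.pi / Complex.sin (Real.pi * s) := by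
  rw [Complex.betaIntegral_eq_Gamma_mul_div _ _ (by simpa using h1) h0]
  rw [← Complex.Gamma_mul_Gamma_one_sub]
  simp [mul_comm]

/-- The Stieltjes transform of a power. -/
theorem stieltjes_cpow {q : ℂ} (h0 : -1 < q.re) (h1 : q.re < 0) {z : ℝ} (hz : 0 < z) :
    IntegrableOn (fun y : ℝ => (y : ℂ) ^ q / ((y : ℂ) + z)) (Ioi 0) ∧
      ∫ y in Ioi (0 : ℝ), (y : ℂ) ^ q / ((y : ℂ) + z) =
        -(Real.pi / Complex.sin (Real.pi * q)) * (z : ℂ) ^ q := by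
  have hderiv : ∀ u ∈ Ioo (0 : ℝ) 1,
      HasDerivWithinAt (fun u : ℝ => z * (u⁻¹ - 1)) (z * -(u ^ 2)⁻¹) (Ioo 0 1) u := fun u hu =>
    (((hasDerivAt_inv hu.1.ne').sub_const 1).const_mul z).hasDerivWithinAt
  have hinj : InjOn (fun u : ℝ => z * (u⁻¹ - 1)) (Ioo 0 1) := by
    intro u _ v _ h
    simpa [hz.ne'] using h
  have himage : (fun u : ℝ => z * (u⁻¹ - 1)) '' Ioo 0 1 = Ioi 0 := by
    ext y
    constructor
    · rintro ⟨u, hu, rfl⟩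
      exact mul_pos hz (sub_pos.2 ((one_lt_inv₀ hu.1).2 hu.2))
    · intro hy
      have hy : 0 < y := hy
      refine ⟨z / (y + z), ⟨by positivity, by rw [div_lt_one (by positivity)]; linarith⟩, ?_⟩
      simp only [inv_div]
      field_simp
      ring
  have hpt : ∀ u ∈ Ioo (0 : ℝ) 1,
      |z * -(u ^ 2)⁻¹| • (((z * (u⁻¹ - 1) : ℝ) : ℂ) ^ q / (((z * (u⁻¹ - 1) : ℝ) : ℂ) + z)) =
        (z : ℂ) ^ q * ((u : ℂ) ^ (1 - (q + 1) - 1) * (1 - (u : ℂ)) ^ (q + 1 - 1)) := by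
    rintro u ⟨hu0, hu1⟩
    have hu1' : 0 < 1 - u := sub_pos.2 hu1
    have e1 : z * (u⁻¹ - 1) = z * ((1 - u) * u⁻¹) := by field_simp
    have e2 : |z * -(u ^ 2)⁻¹| = z * (u ^ 2)⁻¹ := by
      rw [mul_neg, abs_neg, abs_of_pos (by positivity)]
    have hu' : (u : ℂ) ≠ 0 := by exact_mod_cast hu0.ne'
    have hz' : (z : ℂ) ≠ 0 := by exact_mod_cast hz.ne'
    have e3 : ((u⁻¹ : ℝ) : ℂ) ^ q = (u : ℂ) ^ (-q) := by
      rw [Complex.cpow_neg, Complex.ofReal_inv, Complex.inv_cpow]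
      rw [Complex.arg_ofReal_of_nonneg hu0.le]
      exact Real.pi_pos.ne
    have e4 : (u : ℂ) ^ (1 - (q + 1) - 1) = (u : ℂ) ^ (-q) / u := by
      rw [← cpow_sub_one hu']
      ring_nf
    rw [e2, e1, Complex.ofReal_mul, Complex.mul_cpow_ofReal_nonneg hz.le (by positivity),
      Complex.ofReal_mul, Complex.mul_cpow_ofReal_nonneg hu1'.le (by positivity), e3, e4,
      Complex.real_smul]
    have : (z : ℂ) * (((1 - u : ℝ) : ℂ) * ((u⁻¹ : ℝ) : ℂ)) + z = z / u := by
      push_cast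
      field_simp
      ring
    rw [this]
    push_cast
    rw [add_sub_cancel_right]
    field_simp
  have hq0 : 0 < (q + 1).re := by simp; linarith
  have hq1 : (q + 1).re < 1 := by simp; linarith
  have hbeta := Complex.betaIntegral_convergent (u := 1 - (q + 1)) (v := q + 1)
    (by simpa using hq1) hq0
  rw [intervalIntegrable_iff_integrableOn_Ioo_of_le zero_le_one] at hbeta
  rw [← himage, integrableOn_image_iff_integrableOn_abs_deriv_smul measurableSet_Ioo hderiv hinj,
    integral_image_eq_integral_abs_deriv_smul measurableSet_Ioo hderiv hinj,
    integrableOn_congr_fun hpt measurableSet_Ioo, setIntegral_congr_fun measurableSet_Ioo hpt]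
  refine ⟨hbeta.const_mul _, ?_⟩
  rw [integral_const_mul, ← integral_Ioc_eq_integral_Ioo,
    ← intervalIntegral.integral_of_le zero_le_one]
  change _ * Complex.betaIntegral (1 - (q + 1)) (q + 1) = _
  rw [Complex.betaIntegral_one_sub_self hq0 hq1, mul_add, mul_one, Complex.sin_add_pi]
  ring

theorem integral_cpow_div_sq_add {q : ℂ} (h0 : -1 < q.re) (h1 : q.re < 1) {t : ℝ} (ht : 0 < t) :
    IntegrableOn (fun y : ℝ => (y : ℂ) ^ q / ((y : ℂ) ^ 2 + t)) (Ioi 0) ∧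
      ∫ y in Ioi (0 : ℝ), (y : ℂ) ^ q / ((y : ℂ) ^ 2 + t) =
        Real.pi / (2 * Complex.cos (Real.pi * q / 2)) * (t : ℂ) ^ ((q - 1) / 2) := by
  have hre : ((q - 1) / 2).re = (q.re - 1) / 2 := by
    simp
  obtain ⟨hi, he⟩ := stieltjes_cpow (q := (q - 1) / 2) (by rw [hre]; linarith)
    (by rw [hre]; linarith) ht
  have hpt : ∀ y ∈ Ioi (0 : ℝ), ((2 : ℝ) * y ^ ((2 : ℝ) - 1)) •
      ((((y ^ (2 : ℝ) : ℝ)) : ℂ) ^ ((q - 1) / 2) / (((y ^ (2 : ℝ) : ℝ) : ℂ) + t)) =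
        2 * ((y : ℂ) ^ q / ((y : ℂ) ^ 2 + t)) := by
    intro y hy
    have hy : 0 < y := hy
    have hy' : (y : ℂ) ≠ 0 := by exact_mod_cast hy.ne'
    have e : (((y ^ (2 : ℝ) : ℝ)) : ℂ) ^ ((q - 1) / 2) = (y : ℂ) ^ q / y := by
      rw [Real.rpow_two, sq, Complex.ofReal_mul, Complex.mul_cpow_ofReal_nonneg hy.le hy.le,
        ← Complex.cpow_add _ _ hy', ← cpow_sub_one hy']
      ring_nf
    rw [e, Complex.real_smul]
    norm_num
    field_simp
  have hi' := (integrableOn_Ioi_comp_rpow_iff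
    (fun u : ℝ => (u : ℂ) ^ ((q - 1) / 2) / ((u : ℂ) + t)) (two_ne_zero (α := ℝ))).2 hi
  rw [abs_two, integrableOn_congr_fun hpt measurableSet_Ioi] at hi'
  rw [← integral_comp_rpow_Ioi_of_pos (two_pos (α := ℝ)),
    setIntegral_congr_fun measurableSet_Ioi hpt, integral_const_mul] at he
  refine ⟨(integrable_const_mul_iff (by simp) _).1 hi', ?_⟩
  have hs : Complex.sin (Real.pi * ((q - 1) / 2)) = -Complex.cos (Real.pi * q / 2) := by
    rw [show (Real.pi : ℂ) * ((q - 1) / 2) = Real.pi * q / 2 - Real.pi / 2 by ring,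
      Complex.sin_sub_pi_div_two]
  rw [hs] at he
  linear_combination (1 / 2) * he

theorem integral_cpow_div_mul_of_neg {q : ℂ} (h0 : -1 < q.re) (h1 : q.re < 0) {X Y : ℝ}
    (hX : 0 < X) (hY : 0 < Y) (hXY : X ≠ Y) :
    IntegrableOn (fun t : ℝ => (t : ℂ) ^ q / (((t : ℂ) + X) * (t + Y))) (Ioi 0) ∧
      ∫ t in Ioi (0 : ℝ), (t : ℂ) ^ q / (((t : ℂ) + X) * (t + Y)) =
        Real.pi / Complex.sin (Real.pi * q) * ((X : ℂ) ^ q - (Y : ℂ) ^ q) / (X - Y) := by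
  obtain ⟨hiX, heX⟩ := stieltjes_cpow h0 h1 hX
  obtain ⟨hiY, heY⟩ := stieltjes_cpow h0 h1 hY
  have hd : (X : ℂ) - Y ≠ 0 := sub_ne_zero.2 (by exact_mod_cast hXY)
  have hpt : ∀ t ∈ Ioi (0 : ℝ), (t : ℂ) ^ q / (((t : ℂ) + X) * (t + Y)) =
      (1 / ((X : ℂ) - Y)) * ((t : ℂ) ^ q / ((t : ℂ) + Y) - (t : ℂ) ^ q / ((t : ℂ) + X)) := by
    intro t ht
    have ht : 0 < t := ht
    have hX' : (t : ℂ) + X ≠ 0 := by exact_mod_cast (add_pos ht hX).ne'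
    have hY' : (t : ℂ) + Y ≠ 0 := by exact_mod_cast (add_pos ht hY).ne'
    field_simp
    ring
  rw [integrableOn_congr_fun hpt measurableSet_Ioi, setIntegral_congr_fun measurableSet_Ioi hpt,
    integral_const_mul, integral_sub hiY hiX, heX, heY]
  refine ⟨(hiY.sub hiX).const_mul _, ?_⟩
  ring

theorem integral_cpow_div_mul_of_pos {q : ℂ} (h0 : 0 < q.re) (h1 : q.re < 1) {X Y : ℝ}
    (hX : 0 < X) (hY : 0 < Y) (hXY : X ≠ Y) :
    IntegrableOn (fun t : ℝ => (t : ℂ) ^ q / (((t : ℂ) + X) * (t + Y))) (Ioi 0) ∧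
      ∫ t in Ioi (0 : ℝ), (t : ℂ) ^ q / (((t : ℂ) + X) * (t + Y)) =
        Real.pi / Complex.sin (Real.pi * q) * ((X : ℂ) ^ q - (Y : ℂ) ^ q) / (X - Y) := by
  have h0' : -1 < (q - 1).re := by simp; linarith
  have h1' : (q - 1).re < 0 := by simp; linarith
  obtain ⟨hiX, heX⟩ := stieltjes_cpow h0' h1' hX
  obtain ⟨hiY, heY⟩ := stieltjes_cpow h0' h1' hY
  have hd : (X : ℂ) - Y ≠ 0 := sub_ne_zero.2 (by exact_mod_cast hXY)
  have hXc : (X : ℂ) ≠ 0 := by exact_mod_cast hX.ne'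
  have hYc : (Y : ℂ) ≠ 0 := by exact_mod_cast hY.ne'
  have hpt : ∀ t ∈ Ioi (0 : ℝ), (t : ℂ) ^ q / (((t : ℂ) + X) * (t + Y)) =
      (X / ((X : ℂ) - Y)) * ((t : ℂ) ^ (q - 1) / ((t : ℂ) + X)) -
        (Y / ((X : ℂ) - Y)) * ((t : ℂ) ^ (q - 1) / ((t : ℂ) + Y)) := by
    intro t ht
    have ht : 0 < t := ht
    have ht' : (t : ℂ) ≠ 0 := by exact_mod_cast ht.ne'
    have hX' : (t : ℂ) + X ≠ 0 := by exact_mod_cast (add_pos ht hX).ne'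
    have hY' : (t : ℂ) + Y ≠ 0 := by exact_mod_cast (add_pos ht hY).ne'
    rw [cpow_sub_one ht']
    field_simp
    ring
  rw [integrableOn_congr_fun hpt measurableSet_Ioi, setIntegral_congr_fun measurableSet_Ioi hpt,
    integral_sub (hiX.const_mul _) (hiY.const_mul _), integral_const_mul, integral_const_mul,
    heX, heY]
  refine ⟨(hiX.const_mul _).sub (hiY.const_mul _), ?_⟩
  rw [mul_sub, mul_one, Complex.sin_sub_pi, cpow_sub_one hXc, cpow_sub_one hYc]
  field_simp

theorem integral_linear_combination {X : Type*} [MeasurableSpace X] {μ : Measure X}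
    {f g h : X → ℂ} (hf : Integrable f μ) (hg : Integrable g μ) (hh : Integrable h μ)
    (a b c : ℂ) :
    Integrable (fun y => a * f y - b * g y + c * h y) μ ∧
      ∫ y, (a * f y - b * g y + c * h y) ∂μ =
        a * ∫ y, f y ∂μ - b * ∫ y, g y ∂μ + c * ∫ y, h y ∂μ := by
  have hfg : Integrable (fun y => a * f y - b * g y) μ := (hf.const_mul a).sub (hg.const_mul b)
  refine ⟨hfg.add (hh.const_mul c), ?_⟩
  rw [integral_add hfg (hh.const_mul c), integral_sub (hf.const_mul a) (hg.const_mul b),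
    integral_const_mul, integral_const_mul, integral_const_mul]

/-- The kernel of the resolvent, in a form that is visibly symmetric in `x` and `y`. -/
def dixonKernel (α : ℂ) (x y : ℝ) : ℂ :=
  ((x : ℂ) ^ (α + 1) * (y : ℂ) ^ (-α) - (x : ℂ) ^ (-α) * (y : ℂ) ^ (α + 1)) /
    ((x : ℂ) ^ 2 - (y : ℂ) ^ 2)

/-- The integrand representing `dixonKernel` as an absolutely convergent integral. -/
def dixonIntegrand (α : ℂ) (x y t : ℝ) : ℂ :=
  (x : ℂ) ^ (-α) * (y : ℂ) ^ (-α) *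
    ((t : ℂ) ^ (1 / 2 + α) / (((t : ℂ) + (x : ℂ) ^ 2) * ((t : ℂ) + (y : ℂ) ^ 2)))

theorem dixonKernel_comm (α : ℂ) (x y : ℝ) : dixonKernel α x y = dixonKernel α y x := by
  unfold dixonKernel
  rw [← neg_div_neg_eq]
  ring_nf

theorem measurable_dixonKernel (α : ℂ) :
    Measurable (fun p : ℝ × ℝ => dixonKernel α p.1 p.2) := by
  unfold dixonKernel
  fun_prop

theorem sq_cpow {x : ℝ} (hx : 0 < x) (q : ℂ) : ((x ^ 2 : ℝ) : ℂ) ^ q = (x : ℂ) ^ (2 * q) := by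
  rw [sq, Complex.ofReal_mul, Complex.mul_cpow_ofReal_nonneg hx.le hx.le,
    ← Complex.cpow_add _ _ (by exact_mod_cast hx.ne'), two_mul]

theorem cos_pi_mul_ne_zero {α : ℂ} (h0 : -(1 / 2) < α.re) (h1 : α.re < 1 / 2) :
    Complex.cos (Real.pi * α) ≠ 0 := by
  rw [Ne, Complex.cos_eq_zero_iff]
  rintro ⟨k, hk⟩
  have hpi : (Real.pi : ℂ) ≠ 0 := by exact_mod_cast Real.pi_ne_zero
  have hα : α = (((2 * k + 1) / 2 : ℝ) : ℂ) := by
    push_cast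
    field_simp at hk ⊢
    linear_combination hk
  rw [hα, Complex.ofReal_re] at h0 h1
  have a : ((-1 : ℤ) : ℝ) < k := by push_cast; linarith
  have b : (k : ℝ) < ((0 : ℤ) : ℝ) := by push_cast; linarith
  rw [Int.cast_lt] at a b
  omega

theorem sin_pi_mul_ne_zero_of_re_neg {α : ℂ} (h0 : -1 < α.re) (h1 : α.re < 0) :
    Complex.sin (Real.pi * α) ≠ 0 := by
  have := cos_pi_mul_ne_zero (α := α + 1 / 2) (by simp; linarith) (by simp; linarith)
  rwa [mul_add, show (Real.pi : ℂ) * (1 / 2) = Real.pi / 2 by ring, Complex.cos_add_pi_div_two,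
    neg_ne_zero] at this

theorem integral_dixonIntegrand {α : ℂ} (hα1 : -(1 / 2) < α.re) (hα2 : α.re < 0)
    {x y : ℝ} (hx : 0 < x) (hy : 0 < y) (hxy : x ≠ y) :
    IntegrableOn (dixonIntegrand α x y) (Ioi 0) ∧
      ∫ t in Ioi (0 : ℝ), dixonIntegrand α x y t =
        Real.pi / Complex.cos (Real.pi * α) * dixonKernel α x y := by
  have hre : (1 / 2 + α : ℂ).re = 1 / 2 + α.re := by simp
  have hne : x ^ 2 ≠ y ^ 2 := by
    rw [Ne, sq_eq_sq₀ hx.le hy.le]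
    exact hxy
  obtain ⟨hi, he⟩ := integral_cpow_div_mul_of_pos (q := 1 / 2 + α) (by rw [hre]; linarith)
    (by rw [hre]; linarith) (pow_pos hx 2) (pow_pos hy 2) hne
  have hx' : (x : ℂ) ≠ 0 := by exact_mod_cast hx.ne'
  have hy' : (y : ℂ) ≠ 0 := by exact_mod_cast hy.ne'
  have hs : Complex.sin (Real.pi * (1 / 2 + α)) = Complex.cos (Real.pi * α) := by
    rw [show (Real.pi : ℂ) * (1 / 2 + α) = Real.pi * α + Real.pi / 2 by ring,
      Complex.sin_add_pi_div_two]
  have hp : ∀ u : ℂ, u ≠ 0 → u ^ (2 * (1 / 2 + α)) * u ^ (-α) = u ^ (α + 1) := fun u hu => by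
    rw [← Complex.cpow_add _ _ hu]
    ring_nf
  rw [sq_cpow hx, sq_cpow hy, hs] at he
  push_cast at hi he
  refine ⟨hi.const_mul _, ?_⟩
  unfold dixonIntegrand dixonKernel
  rw [integral_const_mul, he, ← hp _ hx', ← hp _ hy']
  ring

theorem integral_cpow_div_sq_add_mul_add {α : ℂ} (hα1 : -(1 / 2) < α.re) (hα2 : α.re < 0)
    {z t : ℝ} (hz : 0 < z) (ht : 0 < t) :
    IntegrableOn (fun y : ℝ => (y : ℂ) ^ (-α) / (((t : ℂ) + (y : ℂ) ^ 2) * (y + z))) (Ioi 0) ∧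
      ∫ y in Ioi (0 : ℝ), (y : ℂ) ^ (-α) / (((t : ℂ) + (y : ℂ) ^ 2) * (y + z)) =
        (Real.pi / Complex.sin (Real.pi * α) * (z : ℂ) ^ (-α) -
          Real.pi / (2 * Complex.sin (Real.pi * α / 2)) * (t : ℂ) ^ (-α / 2) +
          Real.pi / (2 * Complex.cos (Real.pi * α / 2)) * z * (t : ℂ) ^ ((-α - 1) / 2)) /
            ((t : ℂ) + (z : ℂ) ^ 2) := by
  have ht' : (t : ℂ) ≠ 0 := by exact_mod_cast ht.ne'
  have hz' : (z : ℂ) ≠ 0 := by exact_mod_cast hz.ne'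
  have htz : (t : ℂ) + (z : ℂ) ^ 2 ≠ 0 := by exact_mod_cast (by positivity : t + z ^ 2 ≠ 0)
  obtain ⟨i1, e1⟩ := stieltjes_cpow (q := -α - 1) (by simp; linarith) (by simp; linarith) hz
  obtain ⟨i2, e2⟩ := integral_cpow_div_sq_add (q := -α - 1) (by simp; linarith)
    (by simp; linarith) ht
  obtain ⟨i3, e3⟩ := integral_cpow_div_sq_add (q := -α) (by simp; linarith)
    (by simp; linarith) ht
  have hpt : ∀ y ∈ Ioi (0 : ℝ), (y : ℂ) ^ (-α) / (((t : ℂ) + (y : ℂ) ^ 2) * (y + z)) =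
      t / ((t : ℂ) + (z : ℂ) ^ 2) * ((y : ℂ) ^ (-α - 1) / ((y : ℂ) ^ 2 + t)) -
        z / ((t : ℂ) + (z : ℂ) ^ 2) * ((y : ℂ) ^ (-α - 1) / ((y : ℂ) + z)) +
        z / ((t : ℂ) + (z : ℂ) ^ 2) * ((y : ℂ) ^ (-α) / ((y : ℂ) ^ 2 + t)) := by
    intro y hy
    have hy : 0 < y := hy
    have hy' : (y : ℂ) ≠ 0 := by exact_mod_cast hy.ne'
    have h1 : (y : ℂ) + z ≠ 0 := by exact_mod_cast (add_pos hy hz).ne'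
    have h2 : (t : ℂ) + (y : ℂ) ^ 2 ≠ 0 := by exact_mod_cast (by positivity : t + y ^ 2 ≠ 0)
    rw [cpow_sub_one hy', add_comm ((y : ℂ) ^ 2)]
    field_simp
    ring
  rw [integrableOn_congr_fun hpt measurableSet_Ioi, setIntegral_congr_fun measurableSet_Ioi hpt,
    (integral_linear_combination i2 i1 i3 _ _ _).2, e1, e2, e3]
  refine ⟨(integral_linear_combination i2 i1 i3 _ _ _).1, ?_⟩
  have s1 : Complex.sin (Real.pi * (-α - 1)) = Complex.sin (Real.pi * α) := by
    rw [mul_sub, mul_one, Complex.sin_sub_pi, mul_neg, Complex.sin_neg, neg_neg]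
  have s2 : Complex.cos (Real.pi * (-α - 1) / 2) = -Complex.sin (Real.pi * α / 2) := by
    rw [show (Real.pi : ℂ) * (-α - 1) / 2 = -(Real.pi * α / 2) - Real.pi / 2 by ring,
      Complex.cos_sub_pi_div_two, Complex.sin_neg]
  have s3 : Complex.cos (Real.pi * -α / 2) = Complex.cos (Real.pi * α / 2) := by
    rw [show (Real.pi : ℂ) * -α / 2 = -(Real.pi * α / 2) by ring, Complex.cos_neg]
  have s4 : (-α - 1 - 1) / 2 = -α / 2 - 1 := by ring
  rw [s1, s2, s3, s4, cpow_sub_one ht', cpow_sub_one hz']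
  field_simp
  ring

theorem integrable_dixonIntegrand_div_add {α : ℂ} (hα1 : -(1 / 2) < α.re) (hα2 : α.re < 0)
    {x z : ℝ} (hx : 0 < x) (hz : 0 < z) :
    Integrable (fun p : ℝ × ℝ => dixonIntegrand α x p.1 p.2 / ((p.1 : ℂ) + z))
      ((volume.restrict (Ioi 0)).prod (volume.restrict (Ioi 0))) := by
  obtain ⟨i1, -⟩ := stieltjes_cpow (q := -α - 1) (by simp; linarith) (by simp; linarith) hz
  obtain ⟨i2, -⟩ := stieltjes_cpow (q := α) (by linarith) hα2 (pow_pos hx 2)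
  refine ((i1.mul_prod i2).const_mul ((x : ℂ) ^ (-α))).mono ?_ ?_
  · unfold dixonIntegrand
    exact Measurable.aestronglyMeasurable (by fun_prop)
  · rw [Measure.prod_restrict]
    filter_upwards [ae_restrict_mem (measurableSet_Ioi.prod measurableSet_Ioi)] with p hp
    obtain ⟨y, t⟩ := p
    obtain ⟨hy, ht⟩ : 0 < y ∧ 0 < t := hp
    have ht' : (t : ℂ) ≠ 0 := by exact_mod_cast ht.ne'
    have hy' : (y : ℂ) ≠ 0 := by exact_mod_cast hy.ne'
    have h2 : (t : ℂ) + (y : ℂ) ^ 2 ≠ 0 := by exact_mod_cast (by positivity : t + y ^ 2 ≠ 0)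
    have key : dixonIntegrand α x y t / ((y : ℂ) + z) =
        ((x : ℂ) ^ (-α) * ((y : ℂ) ^ (-α - 1) / ((y : ℂ) + z) *
          ((t : ℂ) ^ α / ((t : ℂ) + ((x ^ 2 : ℝ) : ℂ))))) *
          ((y * √t / (t + y ^ 2) : ℝ) : ℂ) := by
      have hsq : (t : ℂ) ^ (1 / 2 : ℂ) = (√t : ℝ) := by
        rw [Real.sqrt_eq_rpow, Complex.ofReal_cpow ht.le]
        norm_num
      unfold dixonIntegrand
      rw [Complex.cpow_add _ _ ht', hsq, cpow_sub_one hy']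
      push_cast
      field_simp
    dsimp only
    rw [key, norm_mul]
    refine mul_le_of_le_one_right (norm_nonneg _) ?_
    rw [Complex.norm_real, Real.norm_of_nonneg (by positivity), div_le_one (by positivity)]
    nlinarith [Real.sq_sqrt ht.le, sq_nonneg (y - √t), sq_nonneg y]

theorem stieltjes_dixonKernel {α : ℂ} (hα1 : -(1 / 2) < α.re) (hα2 : α.re < 0)
    {x z : ℝ} (hx : 0 < x) (hz : 0 < z) (hxz : x ≠ z) :
    IntegrableOn (fun y : ℝ => dixonKernel α x y / ((y : ℂ) + z)) (Ioi 0) ∧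
      ∫ y in Ioi (0 : ℝ), dixonKernel α x y / ((y : ℂ) + z) =
        Real.pi / Complex.sin (Real.pi * α) *
          (dixonKernel α x z - Complex.cos (Real.pi * α) / (x + z)) := by
  have hF := integrable_dixonIntegrand_div_add hα1 hα2 hx hz
  have hcos := cos_pi_mul_ne_zero hα1 (by linarith)
  have hsin := sin_pi_mul_ne_zero_of_re_neg (by linarith) hα2
  have hpi : (Real.pi : ℂ) ≠ 0 := by exact_mod_cast Real.pi_ne_zero
  have hae : (fun y : ℝ => ∫ t in Ioi (0 : ℝ), dixonIntegrand α x y t / ((y : ℂ) + z))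
      =ᵐ[volume.restrict (Ioi 0)] fun y : ℝ =>
        Real.pi / Complex.cos (Real.pi * α) * (dixonKernel α x y / ((y : ℂ) + z)) := by
    filter_upwards [ae_restrict_mem measurableSet_Ioi,
      ae_restrict_of_ae (Measure.ae_ne volume x)] with y hy hyx
    rw [integral_div, (integral_dixonIntegrand hα1 hα2 hx hy hyx.symm).2]
    ring
  have hc : Real.pi / Complex.cos (Real.pi * α) ≠ 0 := div_ne_zero hpi hcos
  refine ⟨(integrable_const_mul_iff hc.isUnit _).1 (hF.integral_prod_left.congr hae), ?_⟩
  refine mul_left_cancel₀ hc ?_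
  rw [← integral_const_mul, ← integral_congr_ae hae, integral_integral_swap hF]
  have hx' : (x : ℂ) ≠ 0 := by exact_mod_cast hx.ne'
  have hz' : (z : ℂ) ≠ 0 := by exact_mod_cast hz.ne'
  have hne : x ^ 2 ≠ z ^ 2 := by
    rw [Ne, sq_eq_sq₀ hx.le hz.le]
    exact hxz
  have hre2 : (1 / 2 + α / 2 : ℂ).re = 1 / 2 + α.re / 2 := by simp
  have hre3 : (α / 2 : ℂ).re = α.re / 2 := by simp
  obtain ⟨i1, e1⟩ := integral_cpow_div_mul_of_pos (q := 1 / 2 + α) (by simp; linarith)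
    (by simp; linarith) (pow_pos hx 2) (pow_pos hz 2) hne
  obtain ⟨i2, e2⟩ := integral_cpow_div_mul_of_pos (q := 1 / 2 + α / 2) (by rw [hre2]; linarith)
    (by rw [hre2]; linarith) (pow_pos hx 2) (pow_pos hz 2) hne
  obtain ⟨i3, e3⟩ := integral_cpow_div_mul_of_neg (q := α / 2) (by rw [hre3]; linarith)
    (by rw [hre3]; linarith) (pow_pos hx 2) (pow_pos hz 2) hne
  have hpt : ∀ t ∈ Ioi (0 : ℝ),
      ∫ y in Ioi (0 : ℝ), dixonIntegrand α x y t / ((y : ℂ) + z) =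
        (x : ℂ) ^ (-α) * (Real.pi / Complex.sin (Real.pi * α) * (z : ℂ) ^ (-α) *
            ((t : ℂ) ^ (1 / 2 + α) / (((t : ℂ) + (x ^ 2 : ℝ)) * (t + (z ^ 2 : ℝ)))) -
          Real.pi / (2 * Complex.sin (Real.pi * α / 2)) *
            ((t : ℂ) ^ (1 / 2 + α / 2) / (((t : ℂ) + (x ^ 2 : ℝ)) * (t + (z ^ 2 : ℝ)))) +
          Real.pi / (2 * Complex.cos (Real.pi * α / 2)) * z *
            ((t : ℂ) ^ (α / 2) / (((t : ℂ) + (x ^ 2 : ℝ)) * (t + (z ^ 2 : ℝ))))) := by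
    intro t ht
    have ht' : (t : ℂ) ≠ 0 := by exact_mod_cast (mem_Ioi.1 ht).ne'
    have : ∀ y : ℝ, dixonIntegrand α x y t / ((y : ℂ) + z) =
        (x : ℂ) ^ (-α) * (t : ℂ) ^ (1 / 2 + α) / ((t : ℂ) + (x : ℂ) ^ 2) *
          ((y : ℂ) ^ (-α) / (((t : ℂ) + (y : ℂ) ^ 2) * (y + z))) := fun y => by
      unfold dixonIntegrand
      simp only [div_eq_mul_inv, mul_inv]
      ring
    simp only [this]
    rw [integral_const_mul, (integral_cpow_div_sq_add_mul_add hα1 hα2 hz ht).2,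
      show 1 / 2 + α / 2 = (1 / 2 + α) + -α / 2 by ring,
      show α / 2 = (1 / 2 + α) + (-α - 1) / 2 by ring, Complex.cpow_add _ (-α / 2) ht',
      Complex.cpow_add _ ((-α - 1) / 2) ht']
    push_cast
    simp only [div_eq_mul_inv, mul_inv]
    ring
  rw [setIntegral_congr_fun measurableSet_Ioi hpt, integral_const_mul,
    (integral_linear_combination i1 i2 i3 _ _ _).2, e1, e2, e3]
  simp only [sq_cpow hx, sq_cpow hz]
  have s1 : Complex.sin (Real.pi * (1 / 2 + α)) = Complex.cos (Real.pi * α) := by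
    rw [show (Real.pi : ℂ) * (1 / 2 + α) = Real.pi * α + Real.pi / 2 by ring,
      Complex.sin_add_pi_div_two]
  have s2 : Complex.sin (Real.pi * (1 / 2 + α / 2)) = Complex.cos (Real.pi * α / 2) := by
    rw [show (Real.pi : ℂ) * (1 / 2 + α / 2) = Real.pi * α / 2 + Real.pi / 2 by ring,
      Complex.sin_add_pi_div_two]
  have s3 : Complex.sin (Real.pi * (α / 2)) = Complex.sin (Real.pi * α / 2) := by
    rw [mul_div_assoc]
  have s4 : Complex.sin (Real.pi * α) =
      2 * Complex.sin (Real.pi * α / 2) * Complex.cos (Real.pi * α / 2) := by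
    rw [← Complex.sin_two_mul]
    ring_nf
  have p1 : ∀ u : ℂ, u ≠ 0 → u ^ (2 * (1 / 2 + α)) = u * (u ^ α * u ^ α) := fun u hu => by
    rw [← Complex.cpow_add _ _ hu, mul_comm u, ← cpow_add_one hu]
    congr 1
    ring
  have p2 : ∀ u : ℂ, u ≠ 0 → u ^ (2 * (1 / 2 + α / 2)) = u * u ^ α := fun u hu => by
    rw [mul_comm u, ← cpow_add_one hu]
    congr 1
    ring
  have p3 : ∀ u : ℂ, u ^ (2 * (α / 2)) = u ^ α := fun u => by ring_nf
  have hxa : (x : ℂ) ^ α ≠ 0 := (Complex.cpow_ne_zero_iff_of_exponent_ne_zero (by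
    rintro rfl; simp at hα2)).2 hx'
  have hza : (z : ℂ) ^ α ≠ 0 := (Complex.cpow_ne_zero_iff_of_exponent_ne_zero (by
    rintro rfl; simp at hα2)).2 hz'
  have hadd : (x : ℂ) + z ≠ 0 := by exact_mod_cast (add_pos hx hz).ne'
  have hsub : (x : ℂ) - z ≠ 0 := sub_ne_zero.2 (by exact_mod_cast hxz)
  have hss : Complex.sin (Real.pi * α / 2) ≠ 0 := fun h => hsin (by rw [s4, h]; ring)
  have hcc : Complex.cos (Real.pi * α / 2) ≠ 0 := fun h => hsin (by rw [s4, h]; ring)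
  unfold dixonKernel
  rw [s1, s2, s3, s4]
  simp only [p1 _ hx', p1 _ hz', p2 _ hx', p2 _ hz', p3, Complex.cpow_neg,
    cpow_add_one hx', cpow_add_one hz']
  push_cast
  rw [sq_sub_sq]
  field_simp
  ring

/-- The positive kernel `∫ ‖dixonIntegrand α x y t‖ dt`, which dominates `dixonKernel α x y`. -/
def dixonMajorant (α : ℂ) (x y : ℝ) : ℝ :=
  ∫ t in Ioi (0 : ℝ), ‖dixonIntegrand α x y t‖

theorem dixonMajorant_nonneg (α : ℂ) (x y : ℝ) : 0 ≤ dixonMajorant α x y :=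
  integral_nonneg fun _ => norm_nonneg _

theorem norm_dixonIntegrand (α : ℂ) {x y t : ℝ} (hx : 0 < x) (hy : 0 < y) (ht : 0 < t) :
    ((‖dixonIntegrand α x y t‖ : ℝ) : ℂ) = dixonIntegrand (α.re : ℂ) x y t := by
  have hX : ‖(t : ℂ) + (x : ℂ) ^ 2‖ = t + x ^ 2 := by
    rw [show (t : ℂ) + (x : ℂ) ^ 2 = ((t + x ^ 2 : ℝ) : ℂ) by push_cast; rfl, Complex.norm_real,
      Real.norm_of_nonneg (by positivity)]
  have hY : ‖(t : ℂ) + (y : ℂ) ^ 2‖ = t + y ^ 2 := by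
    rw [show (t : ℂ) + (y : ℂ) ^ 2 = ((t + y ^ 2 : ℝ) : ℂ) by push_cast; rfl, Complex.norm_real,
      Real.norm_of_nonneg (by positivity)]
  have hre : (1 / 2 + α : ℂ).re = 1 / 2 + α.re := by simp
  unfold dixonIntegrand
  rw [norm_mul, norm_mul, norm_div, norm_mul, hX, hY, Complex.norm_cpow_eq_rpow_re_of_pos hx,
    Complex.norm_cpow_eq_rpow_re_of_pos hy, Complex.norm_cpow_eq_rpow_re_of_pos ht, hre,
    Complex.neg_re]
  push_cast [Complex.ofReal_cpow hx.le, Complex.ofReal_cpow hy.le, Complex.ofReal_cpow ht.le]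
  rfl

theorem ofReal_dixonMajorant {α : ℂ} (hα1 : -(1 / 2) < α.re) (hα2 : α.re < 0) {x y : ℝ}
    (hx : 0 < x) (hy : 0 < y) (hxy : x ≠ y) :
    (dixonMajorant α x y : ℂ) =
      Real.pi / Complex.cos (Real.pi * α.re) * dixonKernel (α.re : ℂ) x y := by
  have h := (integral_dixonIntegrand (α := (α.re : ℂ)) (by simpa using hα1) (by simpa using hα2)
    hx hy hxy).2
  rw [← h, dixonMajorant, ← integral_complex_ofReal]
  exact setIntegral_congr_fun measurableSet_Ioi fun t ht => norm_dixonIntegrand α hx hy ht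

theorem norm_dixonKernel_le_dixonMajorant {α : ℂ} (hα1 : -(1 / 2) < α.re) (hα2 : α.re < 0)
    {x y : ℝ} (hx : 0 < x) (hy : 0 < y) (hxy : x ≠ y) :
    ‖dixonKernel α x y‖ ≤ ‖Complex.cos (Real.pi * α)‖ / Real.pi * dixonMajorant α x y := by
  have hcos := cos_pi_mul_ne_zero hα1 (by linarith)
  have hpi : (Real.pi : ℂ) ≠ 0 := by exact_mod_cast Real.pi_ne_zero
  have h : dixonKernel α x y = Complex.cos (Real.pi * α) / Real.pi *
      ∫ t in Ioi (0 : ℝ), dixonIntegrand α x y t := by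
    rw [(integral_dixonIntegrand hα1 hα2 hx hy hxy).2]
    field_simp
  rw [h, norm_mul, norm_div, Complex.norm_real, Real.norm_of_nonneg Real.pi_pos.le]
  gcongr
  exact norm_integral_le_integral_norm _

theorem sin_pi_mul_neg {a : ℝ} (h0 : -1 < a) (h1 : a < 0) : Real.sin (Real.pi * a) < 0 :=
  Real.sin_neg_of_neg_of_neg_pi_lt (mul_neg_of_pos_of_neg Real.pi_pos h1)
    (by nlinarith [Real.pi_pos])

theorem stieltjes_dixonMajorant {α : ℂ} (hα1 : -(1 / 2) < α.re) (hα2 : α.re < 0) {x z : ℝ}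
    (hx : 0 < x) (hz : 0 < z) (hxz : x ≠ z) :
    IntegrableOn (fun y : ℝ => dixonMajorant α x y / (y + z)) (Ioi 0) ∧
      ∫ y in Ioi (0 : ℝ), dixonMajorant α x y / (y + z) =
        Real.pi / Real.sin (Real.pi * α.re) * (dixonMajorant α x z - Real.pi / (x + z)) := by
  have ha1 : -(1 / 2) < (α.re : ℂ).re := by simpa using hα1
  have ha2 : (α.re : ℂ).re < 0 := by simpa using hα2
  have hcos := cos_pi_mul_ne_zero ha1 (by linarith)
  obtain ⟨hi, he⟩ := stieltjes_dixonKernel ha1 ha2 hx hz hxz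
  have hae : (fun y : ℝ => Real.pi / Complex.cos (Real.pi * α.re) *
      (dixonKernel (α.re : ℂ) x y / ((y : ℂ) + z))) =ᵐ[volume.restrict (Ioi 0)]
        fun y : ℝ => ((dixonMajorant α x y / (y + z) : ℝ) : ℂ) := by
    filter_upwards [ae_restrict_mem measurableSet_Ioi,
      ae_restrict_of_ae (Measure.ae_ne volume x)] with y hy hyx
    push_cast
    rw [ofReal_dixonMajorant hα1 hα2 hx hy hyx.symm, mul_div_assoc]
  refine ⟨?_, ?_⟩
  · have := ((hi.const_mul _).congr hae).re
    simp only [RCLike.re_to_complex, Complex.ofReal_re] at this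
    exact this
  · apply Complex.ofReal_injective
    rw [← integral_complex_ofReal]
    refine (integral_congr_ae hae).symm.trans ?_
    rw [integral_const_mul, he]
    push_cast
    rw [ofReal_dixonMajorant hα1 hα2 hx hz hxz]
    field_simp

theorem dixonMajorant_le {α : ℂ} (hα1 : -(1 / 2) < α.re) (hα2 : α.re < 0) {x z : ℝ}
    (hx : 0 < x) (hz : 0 < z) (hxz : x ≠ z) : dixonMajorant α x z ≤ Real.pi / (x + z) := by
  have h0 : 0 ≤ ∫ y in Ioi (0 : ℝ), dixonMajorant α x y / (y + z) :=
    setIntegral_nonneg measurableSet_Ioi fun y hy =>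
      div_nonneg (dixonMajorant_nonneg _ _ _) (add_pos hy hz).le
  rw [(stieltjes_dixonMajorant hα1 hα2 hx hz hxz).2] at h0
  have hs := div_neg_of_pos_of_neg Real.pi_pos (sin_pi_mul_neg (by linarith) hα2)
  by_contra! h
  exact absurd h0 (mul_neg_of_neg_of_pos hs (sub_pos.2 h)).not_ge

theorem integral_dixonMajorant_div_le {α : ℂ} (hα1 : -(1 / 2) < α.re) (hα2 : α.re < 0) {x z : ℝ}
    (hx : 0 < x) (hz : 0 < z) (hxz : x ≠ z) :
    ∫ y in Ioi (0 : ℝ), dixonMajorant α x y / (y + z) ≤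
      -(Real.pi / Real.sin (Real.pi * α.re)) * (Real.pi / (x + z)) := by
  rw [(stieltjes_dixonMajorant hα1 hα2 hx hz hxz).2]
  have hs := div_neg_of_pos_of_neg Real.pi_pos (sin_pi_mul_neg (by linarith) hα2)
  nlinarith [mul_nonneg (neg_pos.2 hs).le (dixonMajorant_nonneg α x z)]

theorem norm_dixonKernel_le {α : ℂ} (hα1 : -(1 / 2) < α.re) (hα2 : α.re < 0) {x y : ℝ}
    (hx : 0 < x) (hy : 0 < y) :
    ‖dixonKernel α x y‖ ≤ ‖Complex.cos (Real.pi * α)‖ / (x + y) := by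
  rcases eq_or_ne x y with rfl | hxy
  · simp only [dixonKernel, sub_self, div_zero, norm_zero]
    positivity
  · calc
      _ ≤ ‖Complex.cos (Real.pi * α)‖ / Real.pi * dixonMajorant α x y :=
        norm_dixonKernel_le_dixonMajorant hα1 hα2 hx hy hxy
      _ ≤ ‖Complex.cos (Real.pi * α)‖ / Real.pi * (Real.pi / (x + y)) := by
        gcongr
        exact dixonMajorant_le hα1 hα2 hx hy hxy
      _ = _ := by field_simp

theorem exists_integral_norm_dixonKernel_div_le {α : ℂ} (hα1 : -(1 / 2) < α.re)
    (hα2 : α.re < 0) :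
    ∃ C : ℝ, ∀ x z : ℝ, 0 < x → 0 < z → x ≠ z →
      ∫ y in Ioi (0 : ℝ), ‖dixonKernel α x y / ((y : ℂ) + z)‖ ≤ C / (x + z) := by
  refine ⟨‖Complex.cos (Real.pi * α)‖ / Real.pi *
    (-(Real.pi / Real.sin (Real.pi * α.re)) * Real.pi), fun x z hx hz hxz => ?_⟩
  calc
    _ ≤ ∫ y in Ioi (0 : ℝ), ‖Complex.cos (Real.pi * α)‖ / Real.pi *
        (dixonMajorant α x y / (y + z)) := by
      refine integral_mono_ae (stieltjes_dixonKernel hα1 hα2 hx hz hxz).1.norm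
        ((stieltjes_dixonMajorant hα1 hα2 hx hz hxz).1.const_mul _) ?_
      filter_upwards [ae_restrict_mem measurableSet_Ioi,
        ae_restrict_of_ae (Measure.ae_ne volume x)] with y hy hyx
      have hyz : 0 < y + z := add_pos hy hz
      rw [norm_div, ← Complex.ofReal_add, Complex.norm_real, Real.norm_of_nonneg hyz.le,
        ← mul_div_assoc]
      gcongr
      exact norm_dixonKernel_le_dixonMajorant hα1 hα2 hx hy hyx.symm
    _ ≤ ‖Complex.cos (Real.pi * α)‖ / Real.pi *
        (-(Real.pi / Real.sin (Real.pi * α.re)) * (Real.pi / (x + z))) := by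
      rw [integral_const_mul]
      gcongr
      exact integral_dixonMajorant_div_le hα1 hα2 hx hz hxz
    _ = _ := by ring

theorem MemE.aestronglyMeasurable {h : ℝ → ℂ} (hh : MemE h) :
    AEStronglyMeasurable h (volume.restrict (Ioi 0)) := by
  have hm : AEStronglyMeasurable (fun x : ℝ => 1 + (x : ℂ)) (volume.restrict (Ioi 0)) :=
    Measurable.aestronglyMeasurable (by fun_prop)
  have hi : Integrable (fun x : ℝ => h x / (1 + (x : ℂ))) (volume.restrict (Ioi 0)) := hh
  refine (hi.aestronglyMeasurable.mul hm).congr ?_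
  filter_upwards [ae_restrict_mem measurableSet_Ioi] with x hx
  have : 1 + (x : ℂ) ≠ 0 := by exact_mod_cast (add_pos one_pos (mem_Ioi.1 hx)).ne'
  simp only [Pi.mul_apply]
  field_simp

theorem MemE.integrableOn_div_add {h : ℝ → ℂ} (hh : MemE h) {x : ℝ} (hx : 0 < x) :
    IntegrableOn (fun y : ℝ => h y / ((x : ℂ) + (y : ℂ))) (Ioi 0) := by
  have hm : AEStronglyMeasurable (fun y : ℝ => (x : ℂ) + (y : ℂ)) (volume.restrict (Ioi 0)) :=
    Measurable.aestronglyMeasurable (by fun_prop)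
  refine (hh.norm.const_mul (1 + 1 / x)).mono (hh.aestronglyMeasurable.div₀ hm) ?_
  filter_upwards [ae_restrict_mem measurableSet_Ioi] with y hy
  have hy : 0 < y := hy
  rw [← Complex.ofReal_add, ← Complex.ofReal_one, ← Complex.ofReal_add, norm_div, norm_div,
    Complex.norm_real, Complex.norm_real, Real.norm_of_nonneg (by positivity),
    Real.norm_of_nonneg (by positivity), Real.norm_of_nonneg (by positivity), ← mul_div_assoc,
    div_le_div_iff₀ (by positivity) (by positivity)]
  have : 1 + y ≤ (1 + 1 / x) * (x + y) := by
    have : (1 + 1 / x) * (x + y) = x + y + 1 + y / x := by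
      field_simp
      ring
    have : 0 ≤ y / x := by positivity
    linarith
  nlinarith [mul_le_mul_of_nonneg_left this (norm_nonneg (h y))]

theorem MemE.integrableOn_dixonKernel_mul {α : ℂ} (hα1 : -(1 / 2) < α.re) (hα2 : α.re < 0)
    {h : ℝ → ℂ} (hh : MemE h) {x : ℝ} (hx : 0 < x) :
    IntegrableOn (fun y : ℝ => dixonKernel α x y * h y) (Ioi 0) := by
  have hm : AEStronglyMeasurable (dixonKernel α x) (volume.restrict (Ioi 0)) :=
    ((measurable_dixonKernel α).comp measurable_prodMk_left).aestronglyMeasurable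
  refine ((hh.integrableOn_div_add hx).norm.const_mul ‖Complex.cos (Real.pi * α)‖).mono
    (hm.mul hh.aestronglyMeasurable) ?_
  filter_upwards [ae_restrict_mem measurableSet_Ioi] with y hy
  have hy : 0 < y := hy
  rw [norm_mul, Real.norm_of_nonneg (by positivity), norm_div, ← Complex.ofReal_add,
    Complex.norm_real, Real.norm_of_nonneg (add_pos hx hy).le, ← mul_div_assoc, mul_div_right_comm]
  gcongr
  exact norm_dixonKernel_le hα1 hα2 hx hy

/-- The commutation of `dixonKernel` with the Stieltjes transform: the common kernel of both
iterated integrals is computed by `stieltjes_dixonKernel`. -/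
theorem integral_integral_dixonKernel {α : ℂ} (hα1 : -(1 / 2) < α.re) (hα2 : α.re < 0)
    {h : ℝ → ℂ} (hh : MemE h) {x : ℝ} (hx : 0 < x) {k : ℝ → ℝ → ℂ}
    (hk : Measurable (Function.uncurry k))
    (hkx : ∀ z, 0 < z → (∀ y, 0 < y → k y z = dixonKernel α x y / ((y : ℂ) + z)) ∨
      (∀ y, 0 < y → k y z = dixonKernel α z y / ((y : ℂ) + x))) :
    ∫ y in Ioi (0 : ℝ), ∫ z in Ioi (0 : ℝ), k y z * h z =
      Real.pi / Complex.sin (Real.pi * α) * ((∫ z in Ioi (0 : ℝ), dixonKernel α x z * h z) -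
        Complex.cos (Real.pi * α) * ∫ z in Ioi (0 : ℝ), h z / ((x : ℂ) + (z : ℂ))) := by
  obtain ⟨C, hC⟩ := exists_integral_norm_dixonKernel_div_le hα1 hα2
  have hkz : ∀ z, 0 < z → z ≠ x → IntegrableOn (fun y => k y z) (Ioi 0) ∧
      (∫ y in Ioi (0 : ℝ), ‖k y z‖) ≤ C / (x + z) ∧
      ∫ y in Ioi (0 : ℝ), k y z = Real.pi / Complex.sin (Real.pi * α) *
        (dixonKernel α x z - Complex.cos (Real.pi * α) / (x + z)) := by
    intro z hz hzx
    rcases hkx z hz with H | H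
    · replace H : ∀ y ∈ Ioi (0 : ℝ), k y z = dixonKernel α x y / ((y : ℂ) + z) := H
      have hn : ∀ y ∈ Ioi (0 : ℝ), ‖k y z‖ = ‖dixonKernel α x y / ((y : ℂ) + z)‖ :=
        fun y hy => by rw [H y hy]
      rw [integrableOn_congr_fun H measurableSet_Ioi, setIntegral_congr_fun measurableSet_Ioi H,
        setIntegral_congr_fun measurableSet_Ioi hn]
      obtain ⟨h1, h2⟩ := stieltjes_dixonKernel hα1 hα2 hx hz hzx.symm
      exact ⟨h1, hC x z hx hz hzx.symm, h2⟩
    · replace H : ∀ y ∈ Ioi (0 : ℝ), k y z = dixonKernel α z y / ((y : ℂ) + x) := H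
      have hn : ∀ y ∈ Ioi (0 : ℝ), ‖k y z‖ = ‖dixonKernel α z y / ((y : ℂ) + x)‖ :=
        fun y hy => by rw [H y hy]
      rw [integrableOn_congr_fun H measurableSet_Ioi, setIntegral_congr_fun measurableSet_Ioi H,
        setIntegral_congr_fun measurableSet_Ioi hn]
      obtain ⟨h1, h2⟩ := stieltjes_dixonKernel hα1 hα2 hz hx hzx
      rw [dixonKernel_comm α x z, add_comm x z, add_comm (x : ℂ) z]
      exact ⟨h1, hC z x hz hx hzx, h2⟩
  have hmeas : AEStronglyMeasurable (Function.uncurry fun y z => k y z * h z)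
      ((volume.restrict (Ioi 0)).prod (volume.restrict (Ioi 0))) :=
    hk.aestronglyMeasurable.mul hh.aestronglyMeasurable.comp_snd
  have hint : Integrable (Function.uncurry fun y z => k y z * h z)
      ((volume.restrict (Ioi 0)).prod (volume.restrict (Ioi 0))) := by
    rw [integrable_prod_iff' hmeas]
    constructor
    · filter_upwards [ae_restrict_mem measurableSet_Ioi,
        ae_restrict_of_ae (Measure.ae_ne volume x)] with z hz hzx
      exact (hkz z hz hzx).1.mul_const (h z)
    · refine ((hh.integrableOn_div_add hx).norm.const_mul C).mono
        hmeas.norm.prod_swap.integral_prod_right' ?_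
      filter_upwards [ae_restrict_mem measurableSet_Ioi,
        ae_restrict_of_ae (Measure.ae_ne volume x)] with z hz hzx
      have hz : 0 < z := hz
      simp only [Function.uncurry, norm_mul, integral_mul_const]
      rw [norm_div, ← Complex.ofReal_add, Complex.norm_real, Real.norm_of_nonneg (add_pos hx hz).le,
        Real.norm_of_nonneg (integral_nonneg fun _ => norm_nonneg _), norm_norm]
      calc
        _ ≤ C / (x + z) * ‖h z‖ := by
          gcongr
          exact (hkz z hz hzx).2.1
        _ = C * (‖h z‖ / (x + z)) := by ring
        _ ≤ |C| * |‖h z‖ / (x + z)| := by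
          rw [← abs_mul]
          exact le_abs_self _
        _ = _ := by rw [Real.norm_eq_abs, Real.norm_eq_abs]
  rw [integral_integral_swap hint]
  have hae : (fun z : ℝ => ∫ y in Ioi (0 : ℝ), k y z * h z) =ᵐ[volume.restrict (Ioi 0)]
      fun z : ℝ => Real.pi / Complex.sin (Real.pi * α) * (dixonKernel α x z * h z -
        Complex.cos (Real.pi * α) * (h z / ((x : ℂ) + (z : ℂ)))) := by
    filter_upwards [ae_restrict_mem measurableSet_Ioi,
      ae_restrict_of_ae (Measure.ae_ne volume x)] with z hz hzx
    rw [integral_mul_const, (hkz z hz hzx).2.2]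
    ring
  rw [integral_congr_ae hae, integral_const_mul, integral_sub
    (hh.integrableOn_dixonKernel_mul hα1 hα2 hx) ((hh.integrableOn_div_add hx).const_mul _),
    integral_const_mul]

theorem dixonKernel_eq_mul (α : ℂ) {x y : ℝ} (hx : 0 < x) (hy : 0 < y) :
    dixonKernel α x y = x * ((((y / x : ℝ) : ℂ) ^ (-α) - ((y / x : ℝ) : ℂ) ^ (α + 1)) /
      ((x : ℂ) ^ 2 - (y : ℂ) ^ 2)) := by
  have hx' : (x : ℂ) ≠ 0 := by exact_mod_cast hx.ne'
  have hdiv : ∀ q : ℂ, ((y / x : ℝ) : ℂ) ^ q = (y : ℂ) ^ q * (x : ℂ) ^ (-q) := fun q => by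
    rw [div_eq_mul_inv, Complex.ofReal_mul,
      Complex.mul_cpow_ofReal_nonneg hy.le (inv_pos.2 hx).le, Complex.cpow_neg,
      Complex.ofReal_inv, Complex.inv_cpow]
    rw [Complex.arg_ofReal_of_nonneg hx.le]
    exact Real.pi_pos.ne
  rw [hdiv, hdiv, neg_neg, neg_add', cpow_sub_one hx', dixonKernel, cpow_add_one hx',
    mul_div_assoc']
  congr 1
  field_simp

/-- A solution of the Stieltjes equation is given by the resolvent kernel. -/
theorem stieltjes_eq_of_ae_eq {α : ℂ} (hα1 : -(1 / 2) < α.re) (hα2 : α.re < 0) {f g : ℝ → ℂ}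
    (hf : MemE f) (hg : MemE g)
    (H : ∀ᵐ x ∂(volume.restrict (Ioi (0 : ℝ))),
      f x = g x + Complex.sin (Real.pi * α) / Real.pi *
        ∫ y in Ioi (0 : ℝ), f y / ((x : ℂ) + (y : ℂ))) {x : ℝ} (hx : 0 < x) :
    Complex.sin (Real.pi * α) / Real.pi * (∫ y in Ioi (0 : ℝ), f y / ((x : ℂ) + (y : ℂ))) =
      Complex.tan (Real.pi * α) / Real.pi * ∫ y in Ioi (0 : ℝ), dixonKernel α x y * g y := by
  have hcos := cos_pi_mul_ne_zero hα1 (by linarith)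
  have hsin := sin_pi_mul_ne_zero_of_re_neg (by linarith) hα2
  have hpi : (Real.pi : ℂ) ≠ 0 := by exact_mod_cast Real.pi_ne_zero
  have hae : (fun y => dixonKernel α x y * g y) =ᵐ[volume.restrict (Ioi 0)] fun y =>
      dixonKernel α x y * f y - Complex.sin (Real.pi * α) / Real.pi *
        ∫ z in Ioi (0 : ℝ), dixonKernel α x y / ((y : ℂ) + (z : ℂ)) * f z := by
    filter_upwards [H] with y hy
    have : ∀ z : ℝ, dixonKernel α x y / ((y : ℂ) + (z : ℂ)) * f z =
      dixonKernel α x y * (f z / ((y : ℂ) + (z : ℂ))) := fun z => by ring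
    simp only [this]
    rw [integral_const_mul, hy]
    ring
  have hk : Measurable (Function.uncurry fun y z : ℝ =>
      dixonKernel α x y / ((y : ℂ) + (z : ℂ))) :=
    ((measurable_dixonKernel α).comp (measurable_const.prodMk measurable_fst)).div (by fun_prop)
  have hcomm := integral_integral_dixonKernel hα1 hα2 hf hx hk fun z _ => Or.inl fun y _ => rfl
  have hKf := hf.integrableOn_dixonKernel_mul hα1 hα2 hx
  have hKg := hg.integrableOn_dixonKernel_mul hα1 hα2 hx
  have hrest : IntegrableOn (fun y : ℝ => Complex.sin (Real.pi * α) / Real.pi *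
      ∫ z in Ioi (0 : ℝ), dixonKernel α x y / ((y : ℂ) + (z : ℂ)) * f z) (Ioi 0) := by
    refine (hKf.sub hKg).congr ?_
    filter_upwards [hae] with y hy
    simp only [Pi.sub_apply]
    rw [hy]
    ring
  rw [integral_congr_ae hae, integral_sub hKf hrest, integral_const_mul, hcomm,
    Complex.tan_eq_sin_div_cos]
  generalize (∫ y in Ioi (0 : ℝ), dixonKernel α x y * f y) = A
  generalize (∫ y in Ioi (0 : ℝ), f y / ((x : ℂ) + (y : ℂ))) = B
  field_simp
  ring

/-- The function defined by the resolvent kernel solves the Stieltjes equation. -/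
theorem stieltjes_eq_of_ae_eq_resolvent {α : ℂ} (hα1 : -(1 / 2) < α.re) (hα2 : α.re < 0)
    {f g : ℝ → ℂ} (hf : MemE f) (hg : MemE g)
    (H : ∀ᵐ x ∂(volume.restrict (Ioi (0 : ℝ))),
      f x = g x + Complex.tan (Real.pi * α) / Real.pi *
        ∫ y in Ioi (0 : ℝ), dixonKernel α x y * g y) {x : ℝ} (hx : 0 < x) :
    Complex.sin (Real.pi * α) / Real.pi * (∫ y in Ioi (0 : ℝ), f y / ((x : ℂ) + (y : ℂ))) =
      Complex.tan (Real.pi * α) / Real.pi * ∫ y in Ioi (0 : ℝ), dixonKernel α x y * g y := by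
  have hcos := cos_pi_mul_ne_zero hα1 (by linarith)
  have hsin := sin_pi_mul_ne_zero_of_re_neg (by linarith) hα2
  have hpi : (Real.pi : ℂ) ≠ 0 := by exact_mod_cast Real.pi_ne_zero
  have hae : (fun y : ℝ => f y / ((x : ℂ) + (y : ℂ))) =ᵐ[volume.restrict (Ioi 0)] fun y =>
      g y / ((x : ℂ) + (y : ℂ)) + Complex.tan (Real.pi * α) / Real.pi *
        ∫ z in Ioi (0 : ℝ), dixonKernel α z y / ((y : ℂ) + (x : ℂ)) * g z := by
    filter_upwards [H] with y hfy
    have : ∀ z : ℝ, dixonKernel α z y / ((y : ℂ) + (x : ℂ)) * g z =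
      ((x : ℂ) + (y : ℂ))⁻¹ * (dixonKernel α y z * g z) := fun z => by
        rw [dixonKernel_comm α z y, add_comm (x : ℂ)]
        ring
    simp only [this]
    rw [integral_const_mul, hfy]
    ring
  have hk : Measurable (Function.uncurry fun y z : ℝ =>
      dixonKernel α z y / ((y : ℂ) + (x : ℂ))) :=
    ((measurable_dixonKernel α).comp (measurable_snd.prodMk measurable_fst)).div (by fun_prop)
  have hcomm := integral_integral_dixonKernel hα1 hα2 hg hx hk fun z _ => Or.inr fun y _ => rfl
  have hSf := hf.integrableOn_div_add hx
  have hSg := hg.integrableOn_div_add hx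
  have hrest : IntegrableOn (fun y : ℝ => Complex.tan (Real.pi * α) / Real.pi *
      ∫ z in Ioi (0 : ℝ), dixonKernel α z y / ((y : ℂ) + (x : ℂ)) * g z) (Ioi 0) := by
    refine (hSf.sub hSg).congr ?_
    filter_upwards [hae] with y hy
    simp only [Pi.sub_apply]
    rw [hy]
    ring
  rw [integral_congr_ae hae, integral_add hSg hrest, integral_const_mul, hcomm,
    Complex.tan_eq_sin_div_cos]
  generalize (∫ y in Ioi (0 : ℝ), dixonKernel α x y * g y) = A
  generalize (∫ y in Ioi (0 : ℝ), g y / ((x : ℂ) + (y : ℂ))) = B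
  field_simp
  ring

/-- Theorem 1(i): for `-1/2 < Re α < 0`, `λ = sin(πα)/π` and `g ∈ E`,
a function `f ∈ E` satisfies the Stieltjes equation a.e. iff
`f(x) = g(x) + (tan(πα)/π)·x·∫₀^∞ ((y/x)^{-α} - (y/x)^{α+1})/(x²-y²)·g(y) dy` a.e. -/
theorem stmt9 (α : ℂ) (hα1 : -(1/2) < α.re) (hα2 : α.re < 0)
    (lam : ℂ) (hlam : lam = Complex.sin ((Real.pi : ℂ) * α) / (Real.pi : ℂ))
    (g : ℝ → ℂ) (hg : MemE g) (f : ℝ → ℂ) (hf : MemE f) :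
    ((∀ x : ℝ, 0 < x → IntegrableOn (fun y : ℝ => f y / ((x : ℂ) + (y : ℂ))) (Ioi 0)) ∧
      (∀ᵐ x ∂(volume.restrict (Ioi (0 : ℝ))),
        f x = g x + lam * ∫ y in Ioi (0 : ℝ), f y / ((x : ℂ) + (y : ℂ))))
    ↔
    ((∀ x : ℝ, 0 < x → IntegrableOn (fun y : ℝ =>
        (((y / x : ℝ) : ℂ) ^ (-α) - ((y / x : ℝ) : ℂ) ^ (α + 1)) /
          ((x : ℂ) ^ 2 - (y : ℂ) ^ 2) * g y) (Ioi 0)) ∧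
      (∀ᵐ x ∂(volume.restrict (Ioi (0 : ℝ))),
        f x = g x + Complex.tan ((Real.pi : ℂ) * α) / (Real.pi : ℂ) * (x : ℂ) *
          ∫ y in Ioi (0 : ℝ),
            (((y / x : ℝ) : ℂ) ^ (-α) - ((y / x : ℝ) : ℂ) ^ (α + 1)) /
              ((x : ℂ) ^ 2 - (y : ℂ) ^ 2) * g y)) := by
  have hα1' : -(1 / 2) < α.re := hα1
  have hkernel : ∀ x : ℝ, 0 < x → ∀ y ∈ Ioi (0 : ℝ), dixonKernel α x y * g y =
      x * ((((y / x : ℝ) : ℂ) ^ (-α) - ((y / x : ℝ) : ℂ) ^ (α + 1)) /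
          ((x : ℂ) ^ 2 - (y : ℂ) ^ 2) * g y) := fun x hx y hy => by
    rw [dixonKernel_eq_mul α hx hy, mul_assoc]
  have hint : ∀ x : ℝ, 0 < x → IntegrableOn (fun y : ℝ =>
      (((y / x : ℝ) : ℂ) ^ (-α) - ((y / x : ℝ) : ℂ) ^ (α + 1)) /
        ((x : ℂ) ^ 2 - (y : ℂ) ^ 2) * g y) (Ioi 0) := fun x hx => by
    have hx' : (x : ℂ) ≠ 0 := by exact_mod_cast hx.ne'
    have h := hg.integrableOn_dixonKernel_mul hα1' hα2 hx
    rw [integrableOn_congr_fun (hkernel x hx) measurableSet_Ioi] at h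
    exact (integrable_const_mul_iff hx'.isUnit _).1 h
  have hK : ∀ x : ℝ, 0 < x → Complex.tan ((Real.pi : ℂ) * α) / (Real.pi : ℂ) * (x : ℂ) *
      (∫ y in Ioi (0 : ℝ), (((y / x : ℝ) : ℂ) ^ (-α) - ((y / x : ℝ) : ℂ) ^ (α + 1)) /
        ((x : ℂ) ^ 2 - (y : ℂ) ^ 2) * g y) = Complex.tan ((Real.pi : ℂ) * α) / (Real.pi : ℂ) *
      ∫ y in Ioi (0 : ℝ), dixonKernel α x y * g y := fun x hx => by
    rw [setIntegral_congr_fun measurableSet_Ioi (hkernel x hx), integral_const_mul, mul_assoc]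
  rw [and_iff_right fun x hx => hf.integrableOn_div_add hx, and_iff_right hint]
  subst hlam
  constructor
  · intro H
    filter_upwards [ae_restrict_mem measurableSet_Ioi, H] with x hx hfx
    rw [hK x hx, hfx, stieltjes_eq_of_ae_eq hα1' hα2 hf hg H hx]
  · intro H
    have H' : ∀ᵐ x ∂(volume.restrict (Ioi (0 : ℝ))),
        f x = g x + Complex.tan (Real.pi * α) / Real.pi *
          ∫ y in Ioi (0 : ℝ), dixonKernel α x y * g y := by
      filter_upwards [ae_restrict_mem measurableSet_Ioi, H] with x hx hfx
      rw [hfx, hK x hx]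
    filter_upwards [ae_restrict_mem measurableSet_Ioi, H'] with x hx hfx
    rw [hfx, stieltjes_eq_of_ae_eq_resolvent hα1' hα2 hf hg H' hx]

end
end
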